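/- arXiv:math/0405319 — 13 statements merged into one kernel-verified Lean document; each statement's English description precedes it below -/
import Mathlib

section
/- A quadratic differential system ẋ = p(x,y), ẏ = q(x,y) with gcd(p,q) = 1 in ℝ[x,y] has at most 5 pairwise non-proportional invariant affine lines over ℂ; equivalently, together with the line at infinity, it has at most 6 distinct invariant lines in the complex projective plane. -/
open MvPolynomial

noncomputable section

/-- The affine line `u·x + v·y + w = 0` as a polynomial over `ℂ`. -/
def linePoly (u v w : ℂ) : MvPolynomial (Fin 2) ℂ :=
  C u * X 0 + C v * X 1 + C w

/-- `ux + vy + w = 0` (with `(u,v) ≠ (0,0)`) is an invariant affine line of the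
quadratic system `ẋ = p(x,y), ẏ = q(x,y)`: there is a cofactor `k ∈ ℂ[x,y]` with
`p·∂f/∂x + q·∂f/∂y = f·k`. -/
def IsInvLine (p q : MvPolynomial (Fin 2) ℝ) (u v w : ℂ) : Prop :=
  ∃ k : MvPolynomial (Fin 2) ℂ,
    (MvPolynomial.map (algebraMap ℝ ℂ) p) * pderiv 0 (linePoly u v w) +
      (MvPolynomial.map (algebraMap ℝ ℂ) q) * pderiv 1 (linePoly u v w) =
      linePoly u v w * k

lemma aux_deg_pderiv {R : Type*} [Field R] (i : Fin 2) (p : MvPolynomial (Fin 2) R) :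
    (pderiv i p).totalDegree ≤ p.totalDegree - 1 := by
  rw [totalDegree, Finset.sup_le_iff]
  intro m hm
  rw [mem_support_iff, coeff_pderiv] at hm
  have h1 : m + Finsupp.single i 1 ∈ p.support := by
    rw [mem_support_iff]
    exact left_ne_zero_of_mul hm
  have h2 := le_totalDegree h1
  rw [Finsupp.sum_add_index' (by simp) (by simp)] at h2
  simp only [Finsupp.sum_single_index] at h2
  omega

lemma aux_pderiv_const {R : Type*} [Field R] (i : Fin 2) (p : MvPolynomial (Fin 2) R)
    (h : p.totalDegree = 0) : pderiv i p = 0 := by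
  rw [totalDegree_eq_zero_iff_eq_C] at h
  rw [h, pderiv_C]

lemma aux_pderiv_dvd {R : Type*} [Field R] (i : Fin 2) (p : MvPolynomial (Fin 2) R)
    (h : p ∣ pderiv i p) : pderiv i p = 0 := by
  by_contra h0
  have h1 := totalDegree_le_of_dvd_of_isDomain h h0
  have h2 := aux_deg_pderiv i p
  exact h0 (aux_pderiv_const i p (by omega))

lemma aux_coeff_zero {R : Type*} [Field R] [CharZero R] (p : MvPolynomial (Fin 2) R) (i : Fin 2)
    (m : Fin 2 →₀ ℕ) (hm : m i ≠ 0)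
    (h : coeff (m - Finsupp.single i 1) (pderiv i p) = 0) : coeff m p = 0 := by
  rw [coeff_pderiv, mul_eq_zero] at h
  have : m - Finsupp.single i 1 + Finsupp.single i 1 = m := by
    apply tsub_add_cancel_of_le
    rw [Finsupp.single_le_iff]
    omega
  rw [this] at h
  rcases h with h | h
  · exact h
  · exfalso
    exact Nat.cast_add_one_ne_zero _ h

/-- If all second partials vanish then the degree is at most one. -/
lemma aux_deg_le_one {R : Type*} [Field R] [CharZero R] (p : MvPolynomial (Fin 2) R)
    (h : ∀ i j, pderiv j (pderiv i p) = 0) : p.totalDegree ≤ 1 := by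
  rw [totalDegree, Finset.sup_le_iff]
  intro m hm
  rw [mem_support_iff] at hm
  by_contra hc
  rw [Finsupp.sum_fintype _ _ (by simp), Fin.sum_univ_two] at hc
  have key : ∃ i j, m i ≠ 0 ∧ (m - Finsupp.single i 1 : Fin 2 →₀ ℕ) j ≠ 0 := by
    by_cases h0 : m 0 = 0
    · refine ⟨1, 1, by omega, ?_⟩
      simp only [Finsupp.tsub_apply, Finsupp.single_eq_same]
      omega
    · by_cases h1 : m 1 = 0
      · refine ⟨0, 0, by omega, ?_⟩
        simp only [Finsupp.tsub_apply, Finsupp.single_eq_same]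
        omega
      · refine ⟨0, 1, h0, ?_⟩
        simpa using h1
  obtain ⟨i, j, hi, hj⟩ := key
  apply hm
  apply aux_coeff_zero p i m hi
  apply aux_coeff_zero _ j _ hj
  rw [h, coeff_zero]

lemma aux_pderiv_comm {R : Type*} [Field R] (p : MvPolynomial (Fin 2) R) :
    pderiv 0 (pderiv 1 p) = pderiv 1 (pderiv 0 p) := by
  ext m
  simp only [coeff_pderiv, Finsupp.add_apply]
  rw [add_right_comm]
  simp
  ring

/-- The derivation attached to the system. -/
def auxX {R : Type*} [Field R] (p q g : MvPolynomial (Fin 2) R) : MvPolynomial (Fin 2) R :=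
  p * pderiv 0 g + q * pderiv 1 g

/-- The extactic polynomial. -/
def auxE {R : Type*} [Field R] (p q : MvPolynomial (Fin 2) R) : MvPolynomial (Fin 2) R :=
  p * auxX p q q - q * auxX p q p

lemma auxX_deg {R : Type*} [Field R] (p q g : MvPolynomial (Fin 2) R)
    (hp : p.totalDegree ≤ 2) (hq : q.totalDegree ≤ 2) (hg : g.totalDegree ≤ 2) :
    (auxX p q g).totalDegree ≤ 3 := by
  unfold auxX
  have h0 := aux_deg_pderiv 0 g
  have h1 := aux_deg_pderiv 1 g
  have a := totalDegree_mul p (pderiv 0 g)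
  have b := totalDegree_mul q (pderiv 1 g)
  refine (totalDegree_add _ _).trans (max_le ?_ ?_) <;> omega

lemma auxE_deg {R : Type*} [Field R] (p q : MvPolynomial (Fin 2) R)
    (hp : p.totalDegree ≤ 2) (hq : q.totalDegree ≤ 2) :
    (auxE p q).totalDegree ≤ 5 := by
  unfold auxE
  have h0 := auxX_deg p q q hp hq hq
  have h1 := auxX_deg p q p hp hq hp
  have a := totalDegree_mul p (auxX p q q)
  have b := totalDegree_mul q (auxX p q p)
  refine (totalDegree_sub _ _).trans (max_le ?_ ?_) <;> omega

lemma auxE_ne_zero (p q : MvPolynomial (Fin 2) ℝ)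
    (hdeg : max p.totalDegree q.totalDegree = 2)
    (hgcd : IsRelPrime p q) : auxE p q ≠ 0 := by
  intro hE
  have hp0 : p ≠ 0 := by
    rintro rfl
    have hu : IsUnit q := hgcd (dvd_zero _) dvd_rfl
    rw [MvPolynomial.isUnit_iff_totalDegree_of_isReduced] at hu
    simp [hu.2] at hdeg
  have hq0 : q ≠ 0 := by
    rintro rfl
    have hu : IsUnit p := hgcd dvd_rfl (dvd_zero _)
    rw [MvPolynomial.isUnit_iff_totalDegree_of_isReduced] at hu
    simp [hu.2] at hdeg
  unfold auxE auxX at hE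
  have hpy : pderiv 1 p = 0 := by
    apply aux_pderiv_dvd
    have h1 : p ∣ q * (q * pderiv 1 p) :=
      ⟨p * pderiv 0 q + q * pderiv 1 q - q * pderiv 0 p, by linear_combination -hE⟩
    exact hgcd.dvd_of_dvd_mul_left (hgcd.dvd_of_dvd_mul_left h1)
  have hqx : pderiv 0 q = 0 := by
    apply aux_pderiv_dvd
    have h1 : q ∣ p * (p * pderiv 0 q) :=
      ⟨p * pderiv 0 p + q * pderiv 1 p - p * pderiv 1 q, by linear_combination hE⟩
    exact hgcd.symm.dvd_of_dvd_mul_left (hgcd.symm.dvd_of_dvd_mul_left h1)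
  have hh : pderiv 0 p = pderiv 1 q := by
    rw [hpy, hqx] at hE
    have : p * q * (pderiv 1 q - pderiv 0 p) = 0 := by linear_combination hE
    have := (mul_eq_zero.mp this).resolve_left (mul_ne_zero hp0 hq0)
    exact (sub_eq_zero.mp this).symm
  have e1 : pderiv 1 (pderiv 0 p) = 0 := by rw [← aux_pderiv_comm, hpy, map_zero]
  have e2 : pderiv 0 (pderiv 1 q) = 0 := by rw [aux_pderiv_comm, hqx, map_zero]
  have e3 : pderiv 0 (pderiv 0 p) = 0 := by rw [hh, e2]
  have e4 : pderiv 1 (pderiv 1 q) = 0 := by rw [← hh, e1]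
  have d1 : p.totalDegree ≤ 1 := by
    apply aux_deg_le_one
    intro i j
    fin_cases i <;> fin_cases j <;> simp [hpy, e1, e3]
  have d2 : q.totalDegree ≤ 1 := by
    apply aux_deg_le_one
    intro i j
    fin_cases i <;> fin_cases j <;> simp [hqx, e2, e4]
  omega

lemma line_pderiv0 (u v w : ℂ) : pderiv 0 (linePoly u v w) = C u := by
  simp [linePoly]

lemma line_pderiv1 (u v w : ℂ) : pderiv 1 (linePoly u v w) = C v := by
  simp [linePoly]

lemma line_inj {a b c u v w : ℂ} (h : linePoly a b c = linePoly u v w) :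
    a = u ∧ b = v ∧ c = w := by
  have h0 := congrArg (eval ![0, 0]) h
  have h1 := congrArg (eval ![1, 0]) h
  have h2 := congrArg (eval ![0, 1]) h
  simp [linePoly] at h0 h1 h2
  subst h0
  exact ⟨by simpa using h1, by simpa using h2, rfl⟩

lemma line_deg (u v w : ℂ) (h : (u, v) ≠ (0, 0)) : (linePoly u v w).totalDegree = 1 := by
  apply le_antisymm
  · unfold linePoly
    have h1 := totalDegree_mul (C u) (X 0 : MvPolynomial (Fin 2) ℂ)
    have h2 := totalDegree_mul (C v) (X 1 : MvPolynomial (Fin 2) ℂ)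
    rw [totalDegree_C, totalDegree_X] at h1 h2
    refine (totalDegree_add _ _).trans (max_le ((totalDegree_add _ _).trans (max_le ?_ ?_)) ?_)
    · omega
    · omega
    · simp
  · by_contra hc
    have h0 : (linePoly u v w).totalDegree = 0 := by omega
    have hu := aux_pderiv_const 0 _ h0
    have hv := aux_pderiv_const 1 _ h0
    rw [line_pderiv0, C_eq_zero] at hu
    rw [line_pderiv1, C_eq_zero] at hv
    exact h (by rw [hu, hv])

lemma line_ne_zero (u v w : ℂ) (h : (u, v) ≠ (0, 0)) : linePoly u v w ≠ 0 := by
  intro h0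
  have := line_deg u v w h
  simp [h0] at this

lemma line_dvd (P Q : MvPolynomial (Fin 2) ℂ) (u v w : ℂ) (h : (u, v) ≠ (0, 0))
    (k : MvPolynomial (Fin 2) ℂ)
    (hk : P * pderiv 0 (linePoly u v w) + Q * pderiv 1 (linePoly u v w) = linePoly u v w * k) :
    linePoly u v w ∣ auxE P Q := by
  have d0 := congrArg (pderiv 0) hk
  have d1 := congrArg (pderiv 1) hk
  rw [line_pderiv0, line_pderiv1] at hk d0 d1
  simp only [map_add, pderiv_mul, line_pderiv0, line_pderiv1, pderiv_C, mul_zero, add_zero] at d0 d1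
  set f := linePoly u v w
  have hg : f ∣ P * C u + Q * C v := ⟨k, hk⟩
  have hXg : f ∣ C u * auxX P Q P + C v * auxX P Q Q :=
    ⟨k * k + auxX P Q k, by
      unfold auxX
      linear_combination P * d0 + Q * d1 + k * hk⟩
  have hv : f ∣ C v * auxE P Q := by
    have : C v * auxE P Q = P * (C u * auxX P Q P + C v * auxX P Q Q)
        - (P * C u + Q * C v) * auxX P Q P := by unfold auxE; ring
    rw [this]
    exact dvd_sub (hXg.mul_left _) (hg.mul_right _)
  have hu : f ∣ C u * auxE P Q := by
    have : C u * auxE P Q = (P * C u + Q * C v) * auxX P Q Q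
        - Q * (C u * auxX P Q P + C v * auxX P Q Q) := by unfold auxE; ring
    rw [this]
    exact dvd_sub (hg.mul_right _) (hXg.mul_left _)
  by_cases h0 : u = 0
  · have hv0 : v ≠ 0 := fun hv0 => h (by rw [h0, hv0])
    have hun : IsUnit (C v : MvPolynomial (Fin 2) ℂ) := (IsUnit.mk0 v hv0).map C
    exact hun.dvd_mul_left.mp hv
  · have hun : IsUnit (C u : MvPolynomial (Fin 2) ℂ) := (IsUnit.mk0 u h0).map C
    exact hun.dvd_mul_left.mp hu

lemma line_relprime (u v w a b c : ℂ) (h : (u, v) ≠ (0, 0)) (h' : (a, b) ≠ (0, 0))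
    (hn : ¬ ∃ t : ℂ, t ≠ 0 ∧ a = t * u ∧ b = t * v ∧ c = t * w) :
    IsRelPrime (linePoly u v w) (linePoly a b c) := by
  rintro d ⟨s, hs⟩ ⟨t, ht⟩
  have n1 := line_ne_zero u v w h
  have n2 := line_ne_zero a b c h'
  have g1 := line_deg u v w h
  have g2 := line_deg a b c h'
  have hd0 : d ≠ 0 := by rintro rfl; simp at hs; exact n1 hs
  have hs0 : s ≠ 0 := by rintro rfl; simp at hs; exact n1 hs
  have ht0 : t ≠ 0 := by rintro rfl; simp at ht; exact n2 ht
  rw [hs, totalDegree_mul_of_isDomain hd0 hs0] at g1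
  rw [ht, totalDegree_mul_of_isDomain hd0 ht0] at g2
  by_cases hd : d.totalDegree = 0
  · rw [totalDegree_eq_zero_iff_eq_C] at hd
    rw [hd] at hd0 ⊢
    exact (IsUnit.mk0 _ (fun hh => hd0 (by rw [hh, C_0]))).map C
  · exfalso
    have es := totalDegree_eq_zero_iff_eq_C.mp (show s.totalDegree = 0 by omega)
    have et := totalDegree_eq_zero_iff_eq_C.mp (show t.totalDegree = 0 by omega)
    generalize coeff 0 s = x at es
    generalize coeff 0 t = y at et
    subst es et
    have hx : x ≠ 0 := by rintro rfl; simp at hs0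
    have hy : y ≠ 0 := by rintro rfl; simp at ht0
    apply hn
    refine ⟨y / x, div_ne_zero hy hx, ?_⟩
    apply line_inj
    have e : linePoly (y / x * u) (y / x * v) (y / x * w) = C (y / x) * linePoly u v w := by
      simp only [linePoly, C_mul]; ring
    rw [e, hs, ht, mul_left_comm, ← C_mul, div_mul_cancel₀ _ hx]

lemma lines_prod_deg (u v w : Fin 6 → ℂ) (hnz : ∀ i, (u i, v i) ≠ (0, 0)) (s : Finset (Fin 6)) :
    (∏ i ∈ s, linePoly (u i) (v i) (w i)).totalDegree = s.card := by
  induction s using Finset.induction_on with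
  | empty => simp
  | insert i s hi ih =>
    rw [Finset.prod_insert hi, Finset.card_insert_of_notMem hi, totalDegree_mul_of_isDomain
      (line_ne_zero _ _ _ (hnz i))
      (Finset.prod_ne_zero_iff.mpr fun j _ => line_ne_zero _ _ _ (hnz j)), ih,
      line_deg _ _ _ (hnz i), add_comm]


/-- A quadratic differential system `ẋ = p, ẏ = q` with `gcd(p,q) = 1` has at most 5
pairwise non-proportional invariant affine lines over `ℂ`: among any six invariant
affine lines, two of them have proportional coefficient triples. -/
theorem at_most_five_invariant_affine_lines
    (p q : MvPolynomial (Fin 2) ℝ)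
    (hdeg : max p.totalDegree q.totalDegree = 2)
    (hgcd : ∀ d : MvPolynomial (Fin 2) ℝ, d ∣ p → d ∣ q → IsUnit d)
    (u v w : Fin 6 → ℂ)
    (hnz : ∀ i, (u i, v i) ≠ (0, 0))
    (hinv : ∀ i, IsInvLine p q (u i) (v i) (w i)) :
    ∃ i j, i ≠ j ∧ ∃ c : ℂ, c ≠ 0 ∧ u j = c * u i ∧ v j = c * v i ∧ w j = c * w i := by
  by_contra hcon
  have hE := auxE_ne_zero p q hdeg hgcd
  have hmap : MvPolynomial.map (algebraMap ℝ ℂ) (auxE p q) =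
      auxE (MvPolynomial.map (algebraMap ℝ ℂ) p) (MvPolynomial.map (algebraMap ℝ ℂ) q) := by
    simp only [auxE, auxX, map_sub, map_add, map_mul, pderiv_map]
  have hEC : MvPolynomial.map (algebraMap ℝ ℂ) (auxE p q) ≠ 0 := by
    intro h
    apply hE
    apply MvPolynomial.map_injective (algebraMap ℝ ℂ) (algebraMap ℝ ℂ).injective
    rw [h, map_zero]
  have hdvd : ∀ i, linePoly (u i) (v i) (w i) ∣ MvPolynomial.map (algebraMap ℝ ℂ) (auxE p q) := by
    intro i
    obtain ⟨k, hk⟩ := hinv i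
    rw [hmap]
    exact line_dvd _ _ _ _ _ (hnz i) k hk
  have hprod : ∏ i ∈ Finset.univ, linePoly (u i) (v i) (w i) ∣
      MvPolynomial.map (algebraMap ℝ ℂ) (auxE p q) := by
    apply Finset.prod_dvd_of_isRelPrime
    · intro i _ j _ hij
      exact line_relprime _ _ _ _ _ _ (hnz i) (hnz j) (fun h => hcon ⟨i, j, hij, h⟩)
    · intro i _
      exact hdvd i
  have hle := totalDegree_le_of_dvd_of_isDomain hprod hEC
  rw [lines_prod_deg u v w hnz] at hle
  have h5 := auxE_deg p q (by omega) (by omega)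
  have h6 : (MvPolynomial.map (algebraMap ℝ ℂ) (auxE p q)).totalDegree ≤ (auxE p q).totalDegree :=
    Finset.sup_mono (support_map_subset _ _)
  simp at hle
  omega
end
end

section
/- If a quadratic differential system possesses two distinct parallel invariant affine lines ux + vy + w₁ = 0 and ux + vy + w₂ = 0 (same (u,v) ≠ (0,0), w₁ ≠ w₂, coefficients in ℂ), then the binary quadratic form u·p₂(x,y) + v·q₂(x,y) has vanishing discriminant; explicitly, (u·a20 + v·b20)(u·a02 + v·b02) − (u·a11 + v·b11)² = 0. -/
open MvPolynomial

noncomputable section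

/-- `c0 + c10·x + c01·y + c20·x² + 2c11·xy + c02·y²`. -/
def quadPoly (c0 c10 c01 c20 c11 c02 : ℝ) : MvPolynomial (Fin 2) ℝ :=
  C c0 + C c10 * X 0 + C c01 * X 1 +
    C c20 * X 0 ^ 2 + C (2 * c11) * (X 0 * X 1) + C c02 * X 1 ^ 2

lemma inv_eval_aux {a00 a10 a01 a20 a11 a02 b00 b10 b01 b20 b11 b02 : ℝ} {u v w : ℂ}
    (h : IsInvLine (quadPoly a00 a10 a01 a20 a11 a02)
                    (quadPoly b00 b10 b01 b20 b11 b02) u v w) (x y : ℂ)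
    (hxy : u * x + v * y + w = 0) :
    (u * a00 + v * b00) + (u * a10 + v * b10) * x + (u * a01 + v * b01) * y +
      (u * a20 + v * b20) * x ^ 2 + 2 * (u * a11 + v * b11) * x * y
      + (u * a02 + v * b02) * y ^ 2 = 0 := by
  obtain ⟨k, hk⟩ := h
  have := congrArg (MvPolynomial.eval ![x, y]) hk
  simp [linePoly, quadPoly, pderiv_X, hxy] at this
  linear_combination this

lemma disc_aux (A B C D E G u v w₁ w₂ : ℂ) (hu : u ≠ 0) (hw : w₁ ≠ w₂)
    (h₁ : ∀ x y : ℂ, u * x + v * y + w₁ = 0 →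
      G + D * x + E * y + A * x ^ 2 + 2 * B * x * y + C * y ^ 2 = 0)
    (h₂ : ∀ x y : ℂ, u * x + v * y + w₂ = 0 →
      G + D * x + E * y + A * x ^ 2 + 2 * B * x * y + C * y ^ 2 = 0) :
    A * C - B ^ 2 = 0 := by
  have key : ∀ w t : ℂ, u * (-v * t - w / u) + v * (u * t) + w = 0 := by
    intro w t
    field_simp
    ring
  have p0 := h₁ _ _ (key w₁ 0)
  have p1 := h₁ _ _ (key w₁ 1)
  have p2 := h₁ _ _ (key w₁ (-1))
  have q1 := h₂ _ _ (key w₂ 1)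
  have q2 := h₂ _ _ (key w₂ (-1))
  have hq : A * v ^ 2 - 2 * B * u * v + C * u ^ 2 = 0 := by
    linear_combination (p1 + p2 - 2 * p0) / 2
  have hl : (w₁ / u - w₂ / u) * (A * v - B * u) = 0 := by
    linear_combination ((p1 - p2) - (q1 - q2)) / 4
  have hne : w₁ / u - w₂ / u ≠ 0 := by
    rw [← sub_div]
    exact div_ne_zero (sub_ne_zero.2 hw) hu
  have hl2 := (mul_eq_zero.1 hl).resolve_left hne
  have : u ^ 2 * (A * C - B ^ 2) = 0 := by
    linear_combination A * hq - (A * v - B * u) * hl2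
  exact (mul_eq_zero.1 this).resolve_left (pow_ne_zero 2 hu)

/-- If a quadratic differential system possesses two distinct parallel invariant affine
lines `ux + vy + w₁ = 0` and `ux + vy + w₂ = 0`, then the discriminant-type expression
`(u·a20 + v·b20)(u·a02 + v·b02) − (u·a11 + v·b11)²` of the binary quadratic form
`u·p₂ + v·q₂` vanishes. -/
theorem parallel_invariant_lines_discriminant
    (a00 a10 a01 a20 a11 a02 b00 b10 b01 b20 b11 b02 : ℝ)
    (hdeg : ¬ (a20 = 0 ∧ a11 = 0 ∧ a02 = 0 ∧ b20 = 0 ∧ b11 = 0 ∧ b02 = 0))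
    (u v w₁ w₂ : ℂ) (huv : (u, v) ≠ (0, 0)) (hw : w₁ ≠ w₂)
    (h₁ : IsInvLine (quadPoly a00 a10 a01 a20 a11 a02)
                    (quadPoly b00 b10 b01 b20 b11 b02) u v w₁)
    (h₂ : IsInvLine (quadPoly a00 a10 a01 a20 a11 a02)
                    (quadPoly b00 b10 b01 b20 b11 b02) u v w₂) :
    (u * (a20 : ℂ) + v * (b20 : ℂ)) * (u * (a02 : ℂ) + v * (b02 : ℂ))
      - (u * (a11 : ℂ) + v * (b11 : ℂ)) ^ 2 = 0 := by
  have e₁ := inv_eval_aux h₁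
  have e₂ := inv_eval_aux h₂
  by_cases hu : u = 0
  · have hv : v ≠ 0 := fun hv => huv (by rw [hu, hv])
    have := disc_aux (u := v) (v := u) (w₁ := w₁) (w₂ := w₂) (hu := hv) (hw := hw)
      (A := u * a02 + v * b02) (B := u * a11 + v * b11) (C := u * a20 + v * b20)
      (D := u * a01 + v * b01) (E := u * a10 + v * b10) (G := u * a00 + v * b00)
      (h₁ := fun x y h => by linear_combination e₁ y x (by linear_combination h))
      (h₂ := fun x y h => by linear_combination e₂ y x (by linear_combination h))
    linear_combination this
  · exact disc_aux _ _ _ _ _ _ u v w₁ w₂ hu hw e₁ e₂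
end
end

section
/- If a quadratic differential system possesses at least one invariant affine line, then the resultant of C2 and D with respect to x vanishes identically: Res_x(C2(x,y), D(x,y)) = 0 as a polynomial in y (equivalently, the invariant B1 = Res_x(C2,D)/y⁹ vanishes). -/
open MvPolynomial

noncomputable section

/-- The binary quadratic form `c20·x² + 2c11·xy + c02·y²`. -/
def quadForm (c20 c11 c02 : ℝ) : MvPolynomial (Fin 2) ℝ :=
  C c20 * X 0 ^ 2 + C (2 * c11) * (X 0 * X 1) + C c02 * X 1 ^ 2

/-- `C2(x,y) = y·p₂(x,y) − x·q₂(x,y)`. -/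
def C2poly (a20 a11 a02 b20 b11 b02 : ℝ) : MvPolynomial (Fin 2) ℝ :=
  X 1 * quadForm a20 a11 a02 - X 0 * quadForm b20 b11 b02

/-- `D(x,y) = 4·det(c_ij)` where `x·Q(X,Y,Z) − y·P(X,Y,Z)
  = c11·X² + 2c12·XY + c22·Y² + 2c13·XZ + 2c23·YZ + c33·Z²`. -/
def Dpoly (a00 a10 a01 a20 a11 a02 b00 b10 b01 b20 b11 b02 : ℝ) :
    MvPolynomial (Fin 2) ℝ :=
  let c11 : MvPolynomial (Fin 2) ℝ := C b20 * X 0 - C a20 * X 1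
  let c12 : MvPolynomial (Fin 2) ℝ := C b11 * X 0 - C a11 * X 1
  let c22 : MvPolynomial (Fin 2) ℝ := C b02 * X 0 - C a02 * X 1
  let c13 : MvPolynomial (Fin 2) ℝ := C (b10 / 2) * X 0 - C (a10 / 2) * X 1
  let c23 : MvPolynomial (Fin 2) ℝ := C (b01 / 2) * X 0 - C (a01 / 2) * X 1
  let c33 : MvPolynomial (Fin 2) ℝ := C b00 * X 0 - C a00 * X 1
  4 * Matrix.det !![c11, c12, c13; c12, c22, c23; c13, c23, c33]

/-- The coefficient of `x^i·y^j` in a polynomial of `ℝ[x,y]`. -/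
def coeffXY (i j : ℕ) (f : MvPolynomial (Fin 2) ℝ) : ℝ :=
  MvPolynomial.coeff (Finsupp.single (0 : Fin 2) i + Finsupp.single (1 : Fin 2) j) f


def cubForm (t0 t1 t2 t3 : ℝ) : MvPolynomial (Fin 2) ℝ :=
  C t0 * X 0 ^ 3 + C t1 * (X 0 ^ 2 * X 1) + C t2 * (X 0 * X 1 ^ 2) + C t3 * X 1 ^ 3

lemma cubForm_eq (t0 t1 t2 t3 : ℝ) : cubForm t0 t1 t2 t3 =
    monomial (Finsupp.single (0 : Fin 2) 3 + Finsupp.single (1 : Fin 2) 0) t0 +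
    monomial (Finsupp.single (0 : Fin 2) 2 + Finsupp.single (1 : Fin 2) 1) t1 +
    monomial (Finsupp.single (0 : Fin 2) 1 + Finsupp.single (1 : Fin 2) 2) t2 +
    monomial (Finsupp.single (0 : Fin 2) 0 + Finsupp.single (1 : Fin 2) 3) t3 := by
  have h : ∀ (i j : ℕ) (t : ℝ),
      monomial (Finsupp.single (0 : Fin 2) i + Finsupp.single (1 : Fin 2) j) t =
      C t * (X 0 ^ i * X 1 ^ j) := by
    intro i j t
    rw [X_pow_eq_monomial, X_pow_eq_monomial, monomial_mul, C_mul_monomial]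
    simp
  simp only [h, cubForm]
  ring

lemma idx_eq (i j k l : ℕ) : (Finsupp.single (0 : Fin 2) i + Finsupp.single (1 : Fin 2) j =
    Finsupp.single (0 : Fin 2) k + Finsupp.single (1 : Fin 2) l) ↔ (i = k ∧ j = l) := by
  constructor
  · intro h
    have h0 := DFunLike.congr_fun h 0
    have h1 := DFunLike.congr_fun h 1
    simp at h0 h1
    exact ⟨h0, h1⟩
  · rintro ⟨rfl, rfl⟩; rfl

lemma coeff_cub (t0 t1 t2 t3 : ℝ) :
    coeffXY 3 0 (cubForm t0 t1 t2 t3) = t0 ∧ coeffXY 2 1 (cubForm t0 t1 t2 t3) = t1 ∧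
    coeffXY 1 2 (cubForm t0 t1 t2 t3) = t2 ∧ coeffXY 0 3 (cubForm t0 t1 t2 t3) = t3 := by
  simp only [coeffXY, cubForm_eq, coeff_add, coeff_monomial, idx_eq]
  norm_num

lemma C2_eq (a20 a11 a02 b20 b11 b02 : ℝ) : C2poly a20 a11 a02 b20 b11 b02 =
    cubForm (-b20) (a20 - 2 * b11) (2 * a11 - b02) a02 := by
  simp only [C2poly, quadForm, cubForm, map_neg, map_sub, map_mul]
  ring

def dd (a00 a10 a01 a20 a11 a02 b00 b10 b01 b20 b11 b02 : ℝ) : Fin 4 → ℝ :=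
  ![(4)*b20*b02*b00 + (8)*b11*(b10/2)*(b01/2) + (-4)*b20*(b01/2)*(b01/2) + (-4)*b02*(b10/2)*(b10/2) + (-4)*b00*b11*b11,
    (-4)*b20*b02*a00 + (-4)*b20*a02*b00 + (-4)*a20*b02*b00 + (-8)*b11*(b10/2)*(a01/2) + (-8)*b11*(a10/2)*(b01/2) + (-8)*a11*(b10/2)*(b01/2) + (4)*b20*(b01/2)*(a01/2) + (4)*b20*(a01/2)*(b01/2) + (4)*a20*(b01/2)*(b01/2) + (4)*b02*(b10/2)*(a10/2) + (4)*b02*(a10/2)*(b10/2) + (4)*a02*(b10/2)*(b10/2) + (4)*b00*b11*a11 + (4)*b00*a11*b11 + (4)*a00*b11*b11,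
    (4)*b20*a02*a00 + (4)*a20*b02*a00 + (4)*a20*a02*b00 + (8)*b11*(a10/2)*(a01/2) + (8)*a11*(b10/2)*(a01/2) + (8)*a11*(a10/2)*(b01/2) + (-4)*b20*(a01/2)*(a01/2) + (-4)*a20*(b01/2)*(a01/2) + (-4)*a20*(a01/2)*(b01/2) + (-4)*b02*(a10/2)*(a10/2) + (-4)*a02*(b10/2)*(a10/2) + (-4)*a02*(a10/2)*(b10/2) + (-4)*b00*a11*a11 + (-4)*a00*b11*a11 + (-4)*a00*a11*b11,
    (-4)*a20*a02*a00 + (-8)*a11*(a10/2)*(a01/2) + (4)*a20*(a01/2)*(a01/2) + (4)*a02*(a10/2)*(a10/2) + (4)*a00*a11*a11]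

lemma D_eq (a00 a10 a01 a20 a11 a02 b00 b10 b01 b20 b11 b02 : ℝ) :
    Dpoly a00 a10 a01 a20 a11 a02 b00 b10 b01 b20 b11 b02 =
    cubForm (dd a00 a10 a01 a20 a11 a02 b00 b10 b01 b20 b11 b02 0)
      (dd a00 a10 a01 a20 a11 a02 b00 b10 b01 b20 b11 b02 1)
      (dd a00 a10 a01 a20 a11 a02 b00 b10 b01 b20 b11 b02 2)
      (dd a00 a10 a01 a20 a11 a02 b00 b10 b01 b20 b11 b02 3) := by
  simp only [Dpoly, Matrix.det_fin_three, cubForm, dd]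
  simp [Matrix.cons_val_two, Matrix.cons_val_three]
  simp only [show (C 4 : MvPolynomial (Fin 2) ℝ) = 4 from rfl,
    show (C 8 : MvPolynomial (Fin 2) ℝ) = 8 from rfl]
  ring

/-- a symmetric 3×3 form with a 2-dimensional isotropic subspace is degenerate -/
lemma det_zero_aux (m11 m12 m22 m13 m23 m33 a1 a2 x0 y0 : ℂ) (h : a1 ≠ 0 ∨ a2 ≠ 0)
    (haa : m11 * a1 ^ 2 + 2 * m12 * a1 * a2 + m22 * a2 ^ 2 = 0)
    (hab : m11 * a1 * x0 + m12 * (a1 * y0 + a2 * x0) + m22 * a2 * y0 + m13 * a1 + m23 * a2 = 0)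
    (hbb : m11 * x0 ^ 2 + 2 * m12 * x0 * y0 + m22 * y0 ^ 2 + 2 * m13 * x0 + 2 * m23 * y0 + m33 = 0) :
    m11 * m22 * m33 + 2 * m12 * m13 * m23 - m11 * m23 ^ 2 - m22 * m13 ^ 2 - m33 * m12 ^ 2 = 0 := by
  set ab := m11 * a1 * x0 + m12 * (a1 * y0 + a2 * x0) + m22 * a2 * y0 + m13 * a1 + m23 * a2 with eab
  set bb := m11 * x0 ^ 2 + 2 * m12 * x0 * y0 + m22 * y0 ^ 2 + 2 * m13 * x0 + 2 * m23 * y0 + m33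
    with ebb
  rcases h with h | h
  · have h2 : a1 ^ 2 ≠ 0 := pow_ne_zero 2 h
    apply (mul_eq_zero.1 (?_ : a1 ^ 2 * _ = 0)).resolve_left h2
    have ac : ℂ := m12 * a1 + m22 * a2
    linear_combination (bb * m22 - (m12 * x0 + m22 * y0 + m23) ^ 2) * haa
      + (2 * (m12 * x0 + m22 * y0 + m23) * (m12 * a1 + m22 * a2) - m22 * ab) * hab
      - (m12 * a1 + m22 * a2) ^ 2 * hbb
  · have h2 : a2 ^ 2 ≠ 0 := pow_ne_zero 2 h
    apply (mul_eq_zero.1 (?_ : a2 ^ 2 * _ = 0)).resolve_left h2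
    linear_combination (bb * m11 - (m11 * x0 + m12 * y0 + m13) ^ 2) * haa
      + (2 * (m11 * x0 + m12 * y0 + m13) * (m11 * a1 + m12 * a2) - m11 * ab) * hab
      - (m11 * a1 + m12 * a2) ^ 2 * hbb

lemma quad_zero (A B E : ℂ) (h : ∀ t : ℂ, A * t ^ 2 + 2 * B * t + E = 0) :
    A = 0 ∧ B = 0 ∧ E = 0 := by
  have h0 := h 0
  have h1 := h 1
  have h2 := h (-1)
  refine ⟨?_, ?_, ?_⟩
  · linear_combination (h1 + h2) / 2 - h0
  · linear_combination (h1 - h2) / 4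
  · linear_combination h0

lemma eval_quad (c0 c10 c01 c20 c11 c02 : ℝ) (z : Fin 2 → ℂ) :
    eval z (MvPolynomial.map (algebraMap ℝ ℂ) (quadPoly c0 c10 c01 c20 c11 c02)) =
    c0 + c10 * z 0 + c01 * z 1 + c20 * z 0 ^ 2 + 2 * c11 * (z 0 * z 1) + c02 * z 1 ^ 2 := by
  simp [quadPoly]

lemma inv_eval (a00 a10 a01 a20 a11 a02 b00 b10 b01 b20 b11 b02 : ℝ) (u v w : ℂ)
    (h : IsInvLine (quadPoly a00 a10 a01 a20 a11 a02)
                (quadPoly b00 b10 b01 b20 b11 b02) u v w) (x y : ℂ) (hxy : u * x + v * y + w = 0) :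
    u * (a00 + a10 * x + a01 * y + a20 * x ^ 2 + 2 * a11 * (x * y) + a02 * y ^ 2) +
    v * (b00 + b10 * x + b01 * y + b20 * x ^ 2 + 2 * b11 * (x * y) + b02 * y ^ 2) = 0 := by
  obtain ⟨k, hk⟩ := h
  have h := congrArg (eval ![x, y]) hk
  rw [map_add, map_mul, map_mul, map_mul, eval_quad, eval_quad] at h
  have e0 : eval ![x, y] (pderiv 0 (linePoly u v w)) = u := by
    simp [linePoly, pderiv_X, Pi.single_apply]
  have e1 : eval ![x, y] (pderiv 1 (linePoly u v w)) = v := by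
    simp [linePoly, pderiv_X, Pi.single_apply]
  have e2 : eval ![x, y] (linePoly u v w) = 0 := by
    simp [linePoly, hxy]
  rw [e0, e1, e2] at h
  simp at h
  linear_combination h

lemma common_root (a00 a10 a01 a20 a11 a02 b00 b10 b01 b20 b11 b02 : ℝ)
    (hline : ∃ u v w : ℂ, (u, v) ≠ (0, 0) ∧
      IsInvLine (quadPoly a00 a10 a01 a20 a11 a02)
                (quadPoly b00 b10 b01 b20 b11 b02) u v w) :
    ∃ r s : ℂ, (r ≠ 0 ∨ s ≠ 0) ∧
      ((-b20 : ℝ) * r ^ 3 + (a20 - 2 * b11 : ℝ) * r ^ 2 * s + (2 * a11 - b02 : ℝ) * r * s ^ 2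
        + a02 * s ^ 3 = 0) ∧
      (dd a00 a10 a01 a20 a11 a02 b00 b10 b01 b20 b11 b02 0 * r ^ 3
        + dd a00 a10 a01 a20 a11 a02 b00 b10 b01 b20 b11 b02 1 * r ^ 2 * s
        + dd a00 a10 a01 a20 a11 a02 b00 b10 b01 b20 b11 b02 2 * r * s ^ 2
        + dd a00 a10 a01 a20 a11 a02 b00 b10 b01 b20 b11 b02 3 * s ^ 3 = 0) := by
  obtain ⟨u, v, w, huv, h⟩ := hline
  have hne : v ≠ 0 ∨ -u ≠ 0 := by
    by_contra hc
    push Not at hc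
    apply huv
    simp [hc.1, neg_eq_zero.1 hc.2]
  obtain ⟨x0, y0, h0⟩ : ∃ x0 y0 : ℂ, u * x0 + v * y0 + w = 0 := by
    rcases hne with hv | hu
    · exact ⟨0, -w / v, by field_simp; ring⟩
    · have hu' : u ≠ 0 := fun h => hu (by simp [h])
      exact ⟨-w / u, 0, by field_simp; ring⟩
  have hi := inv_eval _ _ _ _ _ _ _ _ _ _ _ _ u v w h
  have key : ∀ t : ℂ, _ := fun t => hi (x0 + v * t) (y0 - u * t) (by linear_combination h0)
  obtain ⟨hA, hB, hE⟩ := quad_zero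
    ((u * a20 + v * b20) * v ^ 2 + 2 * (u * a11 + v * b11) * v * (-u)
      + (u * a02 + v * b02) * (-u) ^ 2)
    ((u * a20 + v * b20) * v * x0 + (u * a11 + v * b11) * (v * y0 + (-u) * x0)
      + (u * a02 + v * b02) * (-u) * y0 + ((u * a10 + v * b10) / 2) * v
      + ((u * a01 + v * b01) / 2) * (-u))
    ((u * a20 + v * b20) * x0 ^ 2 + 2 * (u * a11 + v * b11) * x0 * y0
      + (u * a02 + v * b02) * y0 ^ 2 + 2 * ((u * a10 + v * b10) / 2) * x0
      + 2 * ((u * a01 + v * b01) / 2) * y0 + (u * a00 + v * b00))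
    (fun t => by linear_combination key t)
  refine ⟨v, -u, hne, ?_, ?_⟩
  · push_cast
    linear_combination -hA
  · have hd := det_zero_aux _ _ _ _ _ _ v (-u) x0 y0 hne hA hB hE
    simp [dd, Matrix.cons_val_two, Matrix.cons_val_three]
    linear_combination 4 * hd

lemma sylv_zero (t0 t1 t2 t3 d0 d1 d2 d3 y : ℝ) (r s : ℂ) (h : r ≠ 0 ∨ s ≠ 0)
    (ht : t0 * r ^ 3 + t1 * r ^ 2 * s + t2 * r * s ^ 2 + t3 * s ^ 3 = 0)
    (hd : d0 * r ^ 3 + d1 * r ^ 2 * s + d2 * r * s ^ 2 + d3 * s ^ 3 = 0) :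
    Matrix.det
         !![t0, t1 * y, t2 * y ^ 2, t3 * y ^ 3, 0, 0;
            0, t0, t1 * y, t2 * y ^ 2, t3 * y ^ 3, 0;
            0, 0, t0, t1 * y, t2 * y ^ 2, t3 * y ^ 3;
            d0, d1 * y, d2 * y ^ 2, d3 * y ^ 3, 0, 0;
            0, d0, d1 * y, d2 * y ^ 2, d3 * y ^ 3, 0;
            0, 0, d0, d1 * y, d2 * y ^ 2, d3 * y ^ 3] = 0 := by
  rcases eq_or_ne y 0 with rfl | hy
  · apply Matrix.det_eq_zero_of_column_eq_zero 5
    intro i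
    fin_cases i <;> simp
  · have hyc : (y : ℂ) ≠ 0 := by exact_mod_cast hy
    set M := !![t0, t1 * y, t2 * y ^ 2, t3 * y ^ 3, 0, 0;
            0, t0, t1 * y, t2 * y ^ 2, t3 * y ^ 3, 0;
            0, 0, t0, t1 * y, t2 * y ^ 2, t3 * y ^ 3;
            d0, d1 * y, d2 * y ^ 2, d3 * y ^ 3, 0, 0;
            0, d0, d1 * y, d2 * y ^ 2, d3 * y ^ 3, 0;
            0, 0, d0, d1 * y, d2 * y ^ 2, d3 * y ^ 3] with hM
    have hz : (M.map (algebraMap ℝ ℂ)).det = 0 := by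
      apply Matrix.exists_mulVec_eq_zero_iff.1
      refine ⟨![(r * y) ^ 5, (r * y) ^ 4 * s, (r * y) ^ 3 * s ^ 2, (r * y) ^ 2 * s ^ 3,
        (r * y) * s ^ 4, s ^ 5], ?_, ?_⟩
      · intro h0
        have e0 := congrFun h0 0
        have e5 := congrFun h0 5
        simp at e0 e5
        rcases h with h | h
        · exact e0.elim h hy
        · exact h e5
      · funext i
        fin_cases i <;> simp [hM, Matrix.mulVec, dotProduct, Fin.sum_univ_six]
        · linear_combination (r * y) ^ 2 * y ^ 3 * ht
        · linear_combination (r * y) * s * y ^ 3 * ht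
        · linear_combination s ^ 2 * y ^ 3 * ht
        · linear_combination (r * y) ^ 2 * y ^ 3 * hd
        · linear_combination (r * y) * s * y ^ 3 * hd
        · linear_combination s ^ 2 * y ^ 3 * hd
    have h2 : (algebraMap ℝ ℂ) M.det = 0 := by
      rw [RingHom.map_det]; exact hz
    simpa using h2

/-- If a quadratic differential system possesses at least one invariant affine line, then
`Res_x(C2(x,y), D(x,y)) = 0` identically as a polynomial in `y`; here the resultant with
respect to `x` of the two binary cubics `C2 = t0x³+t1x²y+t2xy²+t3y³` and
`D = d0x³+d1x²y+d2xy²+d3y³` is expressed, for each value of `y`, as the determinant of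
the corresponding 6×6 Sylvester matrix. -/
theorem resultant_C2_D_vanishes
    (a00 a10 a01 a20 a11 a02 b00 b10 b01 b20 b11 b02 : ℝ)
    (hdeg : ¬ (a20 = 0 ∧ a11 = 0 ∧ a02 = 0 ∧ b20 = 0 ∧ b11 = 0 ∧ b02 = 0))
    (hline : ∃ u v w : ℂ, (u, v) ≠ (0, 0) ∧
      IsInvLine (quadPoly a00 a10 a01 a20 a11 a02)
                (quadPoly b00 b10 b01 b20 b11 b02) u v w) :
    ∀ y : ℝ,
      (let t0 := coeffXY 3 0 (C2poly a20 a11 a02 b20 b11 b02)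
       let t1 := coeffXY 2 1 (C2poly a20 a11 a02 b20 b11 b02)
       let t2 := coeffXY 1 2 (C2poly a20 a11 a02 b20 b11 b02)
       let t3 := coeffXY 0 3 (C2poly a20 a11 a02 b20 b11 b02)
       let d0 := coeffXY 3 0 (Dpoly a00 a10 a01 a20 a11 a02 b00 b10 b01 b20 b11 b02)
       let d1 := coeffXY 2 1 (Dpoly a00 a10 a01 a20 a11 a02 b00 b10 b01 b20 b11 b02)
       let d2 := coeffXY 1 2 (Dpoly a00 a10 a01 a20 a11 a02 b00 b10 b01 b20 b11 b02)
       let d3 := coeffXY 0 3 (Dpoly a00 a10 a01 a20 a11 a02 b00 b10 b01 b20 b11 b02)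
       Matrix.det
         !![t0, t1 * y, t2 * y ^ 2, t3 * y ^ 3, 0, 0;
            0, t0, t1 * y, t2 * y ^ 2, t3 * y ^ 3, 0;
            0, 0, t0, t1 * y, t2 * y ^ 2, t3 * y ^ 3;
            d0, d1 * y, d2 * y ^ 2, d3 * y ^ 3, 0, 0;
            0, d0, d1 * y, d2 * y ^ 2, d3 * y ^ 3, 0;
            0, 0, d0, d1 * y, d2 * y ^ 2, d3 * y ^ 3]) = 0 := by
  intro y
  obtain ⟨r, s, hrs, ht, hd⟩ := common_root _ _ _ _ _ _ _ _ _ _ _ _ hline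
  rw [C2_eq, D_eq]
  obtain ⟨h1, h2, h3, h4⟩ := coeff_cub (-b20) (a20 - 2 * b11) (2 * a11 - b02) a02
  obtain ⟨k1, k2, k3, k4⟩ := coeff_cub
    (dd a00 a10 a01 a20 a11 a02 b00 b10 b01 b20 b11 b02 0)
    (dd a00 a10 a01 a20 a11 a02 b00 b10 b01 b20 b11 b02 1)
    (dd a00 a10 a01 a20 a11 a02 b00 b10 b01 b20 b11 b02 2)
    (dd a00 a10 a01 a20 a11 a02 b00 b10 b01 b20 b11 b02 3)
  simp only [h1, h2, h3, h4, k1, k2, k3, k4]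
  exact sylv_zero _ _ _ _ _ _ _ _ y r s hrs ht hd
end
end

section
/- If a quadratic differential system possesses invariant affine lines in at least two distinct directions (i.e., two invariant lines u₁x+v₁y+w₁ = 0 and u₂x+v₂y+w₂ = 0 with (u₁,v₁) and (u₂,v₂) non-proportional over ℂ), then B2(x,y) = 0 identically as a polynomial in x,y. -/
open MvPolynomial

noncomputable section

/-- The transvectant of index 2:
`(f,g)^(2) = f_xx·g_yy − 2·f_xy·g_xy + f_yy·g_xx`. -/
def transvectant2 (f g : MvPolynomial (Fin 2) ℝ) : MvPolynomial (Fin 2) ℝ :=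
  pderiv 0 (pderiv 0 f) * pderiv 1 (pderiv 1 g)
    - 2 * (pderiv 0 (pderiv 1 f) * pderiv 0 (pderiv 1 g))
    + pderiv 1 (pderiv 1 f) * pderiv 0 (pderiv 0 g)

/-- The transvectant of index 3:
`(f,g)^(3) = f_xxx·g_yyy − 3·f_xxy·g_xyy + 3·f_xyy·g_xxy − f_yyy·g_xxx`. -/
def transvectant3 (f g : MvPolynomial (Fin 2) ℝ) : MvPolynomial (Fin 2) ℝ :=
  pderiv 0 (pderiv 0 (pderiv 0 f)) * pderiv 1 (pderiv 1 (pderiv 1 g))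
    - 3 * (pderiv 0 (pderiv 0 (pderiv 1 f)) * pderiv 0 (pderiv 1 (pderiv 1 g)))
    + 3 * (pderiv 0 (pderiv 1 (pderiv 1 f)) * pderiv 0 (pderiv 0 (pderiv 1 g)))
    - pderiv 1 (pderiv 1 (pderiv 1 f)) * pderiv 0 (pderiv 0 (pderiv 0 g))

/-- `B3 = (C2, D)^(1)`, the Jacobian of `C2` and `D`. -/
def B3poly (a00 a10 a01 a20 a11 a02 b00 b10 b01 b20 b11 b02 : ℝ) :
    MvPolynomial (Fin 2) ℝ :=
  pderiv 0 (C2poly a20 a11 a02 b20 b11 b02) *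
      pderiv 1 (Dpoly a00 a10 a01 a20 a11 a02 b00 b10 b01 b20 b11 b02)
    - pderiv 1 (C2poly a20 a11 a02 b20 b11 b02) *
      pderiv 0 (Dpoly a00 a10 a01 a20 a11 a02 b00 b10 b01 b20 b11 b02)

/-- `B2 = (B3,B3)^(2) − 6·B3·(C2,D)^(3)`. -/
def B2poly (a00 a10 a01 a20 a11 a02 b00 b10 b01 b20 b11 b02 : ℝ) :
    MvPolynomial (Fin 2) ℝ :=
  transvectant2 (B3poly a00 a10 a01 a20 a11 a02 b00 b10 b01 b20 b11 b02)
      (B3poly a00 a10 a01 a20 a11 a02 b00 b10 b01 b20 b11 b02)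
    - 6 * B3poly a00 a10 a01 a20 a11 a02 b00 b10 b01 b20 b11 b02 *
        transvectant3 (C2poly a20 a11 a02 b20 b11 b02)
          (Dpoly a00 a10 a01 a20 a11 a02 b00 b10 b01 b20 b11 b02)


def cubAux {R : Type} [CommRing R] (c0 c1 c2 c3 : R) : MvPolynomial (Fin 2) R :=
  C c0 * X 0 ^ 3 + C c1 * (X 0 ^ 2 * X 1) + C c2 * (X 0 * X 1 ^ 2) + C c3 * X 1 ^ 3

def eAux0 (p q r s t u : ℝ) : ℝ := p*r*t

def eAux1 (p q r s t u : ℝ) : ℝ := -(p*r*u+p*s*t+q*r*t)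

def eAux2 (p q r s t u : ℝ) : ℝ := p*s*u+q*r*u+q*s*t

def eAux3 (p q r s t u : ℝ) : ℝ := -(q*s*u)

def dAux0 (a00 a10 a01 a20 a11 a02 b00 b10 b01 b20 b11 b02 : ℝ) : ℝ :=
  4*(eAux0 b20 a20 b02 a02 b00 a00 + 2*eAux0 b11 a11 (b10/2) (a10/2) (b01/2) (a01/2) - eAux0 b20 a20 (b01/2) (a01/2) (b01/2) (a01/2)
    - eAux0 b02 a02 (b10/2) (a10/2) (b10/2) (a10/2) - eAux0 b00 a00 b11 a11 b11 a11)

def dAux1 (a00 a10 a01 a20 a11 a02 b00 b10 b01 b20 b11 b02 : ℝ) : ℝ :=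
  4*(eAux1 b20 a20 b02 a02 b00 a00 + 2*eAux1 b11 a11 (b10/2) (a10/2) (b01/2) (a01/2) - eAux1 b20 a20 (b01/2) (a01/2) (b01/2) (a01/2)
    - eAux1 b02 a02 (b10/2) (a10/2) (b10/2) (a10/2) - eAux1 b00 a00 b11 a11 b11 a11)

def dAux2 (a00 a10 a01 a20 a11 a02 b00 b10 b01 b20 b11 b02 : ℝ) : ℝ :=
  4*(eAux2 b20 a20 b02 a02 b00 a00 + 2*eAux2 b11 a11 (b10/2) (a10/2) (b01/2) (a01/2) - eAux2 b20 a20 (b01/2) (a01/2) (b01/2) (a01/2)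
    - eAux2 b02 a02 (b10/2) (a10/2) (b10/2) (a10/2) - eAux2 b00 a00 b11 a11 b11 a11)

def dAux3 (a00 a10 a01 a20 a11 a02 b00 b10 b01 b20 b11 b02 : ℝ) : ℝ :=
  4*(eAux3 b20 a20 b02 a02 b00 a00 + 2*eAux3 b11 a11 (b10/2) (a10/2) (b01/2) (a01/2) - eAux3 b20 a20 (b01/2) (a01/2) (b01/2) (a01/2)
    - eAux3 b02 a02 (b10/2) (a10/2) (b10/2) (a10/2) - eAux3 b00 a00 b11 a11 b11 a11)


theorem C_half_aux (a : ℝ) : (C a : MvPolynomial (Fin 2) ℝ) = 2 * C (a / 2) := by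
  rw [show (2 : MvPolynomial (Fin 2) ℝ) = C 2 from rfl, ← C_mul]
  congr 1
  ring

theorem Dpoly_cubAux (a00 a10 a01 a20 a11 a02 b00 b10 b01 b20 b11 b02 : ℝ) :
    Dpoly a00 a10 a01 a20 a11 a02 b00 b10 b01 b20 b11 b02 = cubAux (dAux0 a00 a10 a01 a20 a11 a02 b00 b10 b01 b20 b11 b02)
      (dAux1 a00 a10 a01 a20 a11 a02 b00 b10 b01 b20 b11 b02)
      (dAux2 a00 a10 a01 a20 a11 a02 b00 b10 b01 b20 b11 b02)
      (dAux3 a00 a10 a01 a20 a11 a02 b00 b10 b01 b20 b11 b02) := by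
  have h4 : (C 4 : MvPolynomial (Fin 2) ℝ) = 4 := rfl
  have h2 : (C 2 : MvPolynomial (Fin 2) ℝ) = 2 := rfl
  simp only [Dpoly, cubAux, dAux0, eAux0, dAux1, eAux1, dAux2, eAux2, dAux3, eAux3, Matrix.det_fin_three, C_mul, C_add, C_sub, C_neg, h2, h4]
  simp
  ring

theorem C2poly_cubAux (a20 a11 a02 b20 b11 b02 : ℝ) :
    C2poly a20 a11 a02 b20 b11 b02 = cubAux (-b20) (a20 - 2 * b11) (2 * a11 - b02) a02 := by
  have h2 : (C 2 : MvPolynomial (Fin 2) ℝ) = 2 := rfl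
  simp only [C2poly, quadForm, cubAux, C_mul, C_add, C_sub, C_neg, h2]
  ring

theorem map_cubAux (c0 c1 c2 c3 : ℝ) :
    MvPolynomial.map (algebraMap ℝ ℂ) (cubAux c0 c1 c2 c3) =
      cubAux (c0 : ℂ) (c1 : ℂ) (c2 : ℂ) (c3 : ℂ) := by
  simp [cubAux]

theorem fac_aux (c0 c1 c2 c3 r1 s1 r2 s2 : ℂ) (hd : r1 * s2 - r2 * s1 ≠ 0)
    (h1 : c0 * r1 ^ 3 + c1 * (r1 ^ 2 * s1) + c2 * (r1 * s1 ^ 2) + c3 * s1 ^ 3 = 0)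
    (h2 : c0 * r2 ^ 3 + c1 * (r2 ^ 2 * s2) + c2 * (r2 * s2 ^ 2) + c3 * s2 ^ 3 = 0) :
    ∃ m0 m1 : ℂ, c0 = s1 * s2 * m0 ∧ c1 = s1 * s2 * m1 - (s1 * r2 + r1 * s2) * m0 ∧
      c2 = -(s1 * r2 + r1 * s2) * m1 + r1 * r2 * m0 ∧ c3 = r1 * r2 * m1 := by
  obtain ⟨G1, hG1⟩ : ∃ G, G = r2*(3*c0*r1^2+2*c1*r1*s1+c2*s1^2)
    + s2*(c1*r1^2+2*c2*r1*s1+3*c3*s1^2) := ⟨_, rfl⟩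
  obtain ⟨G2, hG2⟩ : ∃ G, G = r1*(3*c0*r2^2+2*c1*r2*s2+c2*s2^2)
    + s1*(c1*r2^2+2*c2*r2*s2+3*c3*s2^2) := ⟨_, rfl⟩
  obtain ⟨i, hi⟩ : ∃ i, (r1 * s2 - r2 * s1) ^ 3 * i = 1 :=
    ⟨_, mul_inv_cancel₀ (pow_ne_zero 3 hd)⟩
  refine ⟨-(s2 * G1 - s1 * G2) * i,
    -(r1 * G2 - r2 * G1) * i, ?_, ?_, ?_, ?_⟩
  · subst hG1 hG2
    linear_combination i * (s2^3 * h1 - s1^3 * h2) - c0 * hi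
  · subst hG1 hG2
    linear_combination i * (-3*s2^2*r2 * h1 + 3*s1^2*r1 * h2) - c1 * hi
  · subst hG1 hG2
    linear_combination i * (3*s2*r2^2 * h1 - 3*s1*r1^2 * h2) - c2 * hi
  · subst hG1 hG2
    linear_combination i * (-r2^3 * h1 + r1^3 * h2) - c3 * hi

theorem pd0_cubAux (c0 c1 c2 c3 : ℂ) : pderiv 0 (cubAux c0 c1 c2 c3) =
    3 * C c0 * X 0 ^ 2 + 2 * C c1 * (X 0 * X 1) + C c2 * X 1 ^ 2 := by
  simp [cubAux, pderiv_X, Pi.single_apply]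
  ring

theorem pd1_cubAux (c0 c1 c2 c3 : ℂ) : pderiv 1 (cubAux c0 c1 c2 c3) =
    C c1 * X 0 ^ 2 + 2 * C c2 * (X 0 * X 1) + 3 * C c3 * X 1 ^ 2 := by
  simp [cubAux, pderiv_X, Pi.single_apply]
  ring

theorem pd0_quadAux (c0 c1 c2 : MvPolynomial (Fin 2) ℂ)
    (h0 : pderiv 0 c0 = 0) (h1 : pderiv 0 c1 = 0) (h2 : pderiv 0 c2 = 0) :
    pderiv 0 (c0 * X 0 ^ 2 + c1 * (X 0 * X 1) + c2 * X 1 ^ 2) = 2 * c0 * X 0 + c1 * X 1 := by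
  simp [pderiv_X, Pi.single_apply, h0, h1, h2]
  ring

theorem B2_fac_aux (f0 f1 f2 m0 m1 n0 n1 : ℂ) (A B J : MvPolynomial (Fin 2) ℂ)
    (hA : A = cubAux (f0*m0) (f0*m1+f1*m0) (f1*m1+f2*m0) (f2*m1))
    (hB : B = cubAux (f0*n0) (f0*n1+f1*n0) (f1*n1+f2*n0) (f2*n1))
    (hJ : J = pderiv 0 A * pderiv 1 B - pderiv 1 A * pderiv 0 B) :
    pderiv 0 (pderiv 0 J) * pderiv 1 (pderiv 1 J)
    - 2 * (pderiv 0 (pderiv 1 J) * pderiv 0 (pderiv 1 J))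
    + pderiv 1 (pderiv 1 J) * pderiv 0 (pderiv 0 J)
    - 6 * J * (pderiv 0 (pderiv 0 (pderiv 0 A)) * pderiv 1 (pderiv 1 (pderiv 1 B))
    - 3 * (pderiv 0 (pderiv 0 (pderiv 1 A)) * pderiv 0 (pderiv 1 (pderiv 1 B)))
    + 3 * (pderiv 0 (pderiv 1 (pderiv 1 A)) * pderiv 0 (pderiv 0 (pderiv 1 B)))
    - pderiv 1 (pderiv 1 (pderiv 1 A)) * pderiv 0 (pderiv 0 (pderiv 0 B))) = 0 := by
  have h2 : (2 : MvPolynomial (Fin 2) ℂ) = C 2 := rfl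
  have h3 : (3 : MvPolynomial (Fin 2) ℂ) = C 3 := rfl
  obtain ⟨F, hF⟩ : ∃ F : MvPolynomial (Fin 2) ℂ,
    F = C f0 * X 0 ^ 2 + C f1 * (X 0 * X 1) + C f2 * X 1 ^ 2 := ⟨_, rfl⟩
  have F0 : pderiv 0 F = 2 * C f0 * X 0 + C f1 * X 1 := by
    simp [hF, pderiv_X, Pi.single_apply]; ring
  have F1 : pderiv 1 F = C f1 * X 0 + 2 * C f2 * X 1 := by
    simp [hF, pderiv_X, Pi.single_apply]; ring
  have e2 : ∀ i : Fin 2, pderiv i (2 : MvPolynomial (Fin 2) ℂ) = 0 := by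
    intro i; rw [h2]; exact pderiv_C
  have e3 : ∀ i : Fin 2, pderiv i (3 : MvPolynomial (Fin 2) ℂ) = 0 := by
    intro i; rw [h3]; exact pderiv_C
  have hJ2 : J = C (3 * (m0 * n1 - m1 * n0)) * F ^ 2 := by
    rw [hJ, hA, hB, pd0_cubAux, pd1_cubAux, pd0_cubAux, pd1_cubAux, hF]
    simp only [C_mul, C_add, C_sub, ← h3]
    ring
  have hT : (pderiv 0 (pderiv 0 (pderiv 0 A)) * pderiv 1 (pderiv 1 (pderiv 1 B))
    - 3 * (pderiv 0 (pderiv 0 (pderiv 1 A)) * pderiv 0 (pderiv 1 (pderiv 1 B)))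
    + 3 * (pderiv 0 (pderiv 1 (pderiv 1 A)) * pderiv 0 (pderiv 0 (pderiv 1 B)))
    - pderiv 1 (pderiv 1 (pderiv 1 A)) * pderiv 0 (pderiv 0 (pderiv 0 B)))
      = -12 * (C m0 * C n1 - C m1 * C n0) * (C f1 ^ 2 - 4 * C f0 * C f2) := by
    rw [hA, hB]
    simp only [pd0_cubAux, pd1_cubAux]
    simp [pderiv_X, Pi.single_apply, e2, e3]
    ring
  have J0 : pderiv 0 J = C (3 * (m0 * n1 - m1 * n0)) * (2 * F * pderiv 0 F) := by
    rw [hJ2]; simp [pderiv_pow]; left; ring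
  have J1 : pderiv 1 J = C (3 * (m0 * n1 - m1 * n0)) * (2 * F * pderiv 1 F) := by
    rw [hJ2]; simp [pderiv_pow]; left; ring
  have J00 : pderiv 0 (pderiv 0 J) = C (3 * (m0 * n1 - m1 * n0)) *
      (2 * (pderiv 0 F) ^ 2 + 4 * F * C f0) := by
    rw [J0, pderiv_C_mul, Derivation.leibniz, F0]
    simp [pderiv_X, Pi.single_apply, e2, F0, smul_eq_C_mul]; left; ring
  have J01 : pderiv 0 (pderiv 1 J) = C (3 * (m0 * n1 - m1 * n0)) *
      (2 * pderiv 0 F * pderiv 1 F + 2 * F * C f1) := by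
    rw [J1, pderiv_C_mul, Derivation.leibniz, F1]
    simp [pderiv_X, Pi.single_apply, e2, F0, smul_eq_C_mul]; left; ring
  have J11 : pderiv 1 (pderiv 1 J) = C (3 * (m0 * n1 - m1 * n0)) *
      (2 * (pderiv 1 F) ^ 2 + 4 * F * C f2) := by
    rw [J1, pderiv_C_mul, Derivation.leibniz, F1]
    simp [pderiv_X, Pi.single_apply, e2, F1, smul_eq_C_mul]; left; ring
  rw [hT, J00, J01, J11, hJ2, F0, F1, hF]
  simp only [C_mul, C_add, C_sub, ← h3]
  ring

theorem det_aux (A B E D G F s r : ℂ)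
    (h0 : E * r ^ 2 + 2 * G * r + F = 0)
    (h1 : A + 2 * B * s + E * s ^ 2 + 2 * (B * r + E * s * r + D + G * s)
      + (E * r ^ 2 + 2 * G * r + F) = 0)
    (h2 : A + 2 * B * s + E * s ^ 2 - 2 * (B * r + E * s * r + D + G * s)
      + (E * r ^ 2 + 2 * G * r + F) = 0) :
    A + 2 * B * s + E * s ^ 2 = 0 ∧
    A * E * F + 2 * B * D * G - A * G ^ 2 - E * D ^ 2 - F * B ^ 2 = 0 := by
  have k1 : A = -(2 * B * s + E * s ^ 2) := by linear_combination (h1 + h2) / 2 - h0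
  have k2 : D = -(B * r + E * s * r + G * s) := by linear_combination (h1 - h2) / 4
  have k3 : F = -(E * r ^ 2 + 2 * G * r) := by linear_combination h0
  subst k1 k2 k3
  constructor <;> ring

theorem inv_aux (a00 a10 a01 a20 a11 a02 b00 b10 b01 b20 b11 b02 : ℝ) (u v w : ℂ)
    (hnz : (u, v) ≠ (0, 0))
    (h : IsInvLine (quadPoly a00 a10 a01 a20 a11 a02)
                    (quadPoly b00 b10 b01 b20 b11 b02) u v w) :
    (u * a20 + v * b20) * v ^ 2 - 2 * (u * a11 + v * b11) * u * v + (u * a02 + v * b02) * u ^ 2 = 0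
    ∧ (u * a20 + v * b20) * (u * a02 + v * b02) * (u * a00 + v * b00)
      + 2 * (u * a11 + v * b11) * ((u * a10 + v * b10) / 2) * ((u * a01 + v * b01) / 2)
      - (u * a20 + v * b20) * ((u * a01 + v * b01) / 2) ^ 2
      - (u * a02 + v * b02) * ((u * a10 + v * b10) / 2) ^ 2
      - (u * a00 + v * b00) * (u * a11 + v * b11) ^ 2 = 0 := by
  obtain ⟨k, hk⟩ := h
  have key : ∀ x y : ℂ, u * x + v * y + w = 0 →
      (u * a00 + v * b00) + (u * a10 + v * b10) * x + (u * a01 + v * b01) * y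
      + (u * a20 + v * b20) * x ^ 2 + 2 * (u * a11 + v * b11) * (x * y)
      + (u * a02 + v * b02) * y ^ 2 = 0 := by
    intro x y hxy
    have := congrArg (MvPolynomial.eval ![x, y]) hk
    simp [linePoly, quadPoly, pderiv_X, Pi.single_apply, hxy] at this
    linear_combination this
  by_cases hv : v = 0
  · have hu : u ≠ 0 := by
      rintro rfl
      exact hnz (by rw [hv])
    have L : ∀ t : ℂ, u * (-v / u * t + -w / u) + v * t + w = 0 := by
      intro t; field_simp; ring
    have := det_aux (u * a02 + v * b02) (u * a11 + v * b11) (u * a20 + v * b20)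
      ((u * a01 + v * b01) / 2) ((u * a10 + v * b10) / 2) (u * a00 + v * b00) (-v / u) (-w / u)
      (by linear_combination key _ _ (L 0)) (by linear_combination key _ _ (L 1))
      (by linear_combination key _ _ (L (-1)))
    refine ⟨?_, by linear_combination this.2⟩
    have h1 := this.1
    field_simp at h1
    linear_combination h1
  · have L : ∀ t : ℂ, u * t + v * (-u / v * t + -w / v) + w = 0 := by
      intro t; field_simp; ring
    have := det_aux (u * a20 + v * b20) (u * a11 + v * b11) (u * a02 + v * b02)
      ((u * a10 + v * b10) / 2) ((u * a01 + v * b01) / 2) (u * a00 + v * b00) (-u / v) (-w / v)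
      (by linear_combination key _ _ (L 0)) (by linear_combination key _ _ (L 1))
      (by linear_combination key _ _ (L (-1)))
    refine ⟨?_, this.2⟩
    have h1 := this.1
    field_simp at h1
    linear_combination h1

theorem inv_aux_C2 (a20 a11 a02 b20 b11 b02 : ℝ) (u v : ℂ)
    (h : (u * a20 + v * b20) * v ^ 2 - 2 * (u * a11 + v * b11) * u * v
      + (u * a02 + v * b02) * u ^ 2 = 0) :
    ((-b20 : ℝ) : ℂ) * v ^ 3 + ((a20 - 2 * b11 : ℝ) : ℂ) * (v ^ 2 * (-u))
      + ((2 * a11 - b02 : ℝ) : ℂ) * (v * (-u) ^ 2) + (a02 : ℂ) * (-u) ^ 3 = 0 := by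
  push_cast
  linear_combination -h

theorem inv_aux_D (a00 a10 a01 a20 a11 a02 b00 b10 b01 b20 b11 b02 : ℝ) (u v : ℂ)
    (h : (u * a20 + v * b20) * (u * a02 + v * b02) * (u * a00 + v * b00)
      + 2 * (u * a11 + v * b11) * ((u * a10 + v * b10) / 2) * ((u * a01 + v * b01) / 2)
      - (u * a20 + v * b20) * ((u * a01 + v * b01) / 2) ^ 2
      - (u * a02 + v * b02) * ((u * a10 + v * b10) / 2) ^ 2
      - (u * a00 + v * b00) * (u * a11 + v * b11) ^ 2 = 0) :
    (dAux0 a00 a10 a01 a20 a11 a02 b00 b10 b01 b20 b11 b02 : ℂ) * v ^ 3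
      + (dAux1 a00 a10 a01 a20 a11 a02 b00 b10 b01 b20 b11 b02 : ℂ) * (v ^ 2 * (-u))
      + (dAux2 a00 a10 a01 a20 a11 a02 b00 b10 b01 b20 b11 b02 : ℂ) * (v * (-u) ^ 2)
      + (dAux3 a00 a10 a01 a20 a11 a02 b00 b10 b01 b20 b11 b02 : ℂ) * (-u) ^ 3 = 0 := by
  simp only [dAux0, eAux0, dAux1, eAux1, dAux2, eAux2, dAux3, eAux3]
  push_cast
  linear_combination 4 * h

/-- If a quadratic differential system possesses invariant affine lines in at least two
distinct directions, then `B2 = 0` identically. -/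
theorem B2_vanishes_of_two_directions
    (a00 a10 a01 a20 a11 a02 b00 b10 b01 b20 b11 b02 : ℝ)
    (hdeg : ¬ (a20 = 0 ∧ a11 = 0 ∧ a02 = 0 ∧ b20 = 0 ∧ b11 = 0 ∧ b02 = 0))
    (u₁ v₁ w₁ u₂ v₂ w₂ : ℂ)
    (h₁nz : (u₁, v₁) ≠ (0, 0)) (h₂nz : (u₂, v₂) ≠ (0, 0))
    (hdir : ¬ ∃ c : ℂ, u₂ = c * u₁ ∧ v₂ = c * v₁)
    (h₁ : IsInvLine (quadPoly a00 a10 a01 a20 a11 a02)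
                    (quadPoly b00 b10 b01 b20 b11 b02) u₁ v₁ w₁)
    (h₂ : IsInvLine (quadPoly a00 a10 a01 a20 a11 a02)
                    (quadPoly b00 b10 b01 b20 b11 b02) u₂ v₂ w₂) :
    B2poly a00 a10 a01 a20 a11 a02 b00 b10 b01 b20 b11 b02 = 0 := by
  have hd : v₁ * (-u₂) - v₂ * (-u₁) ≠ 0 := by
    intro h0
    apply hdir
    by_cases hu : u₁ = 0
    · have hv : v₁ ≠ 0 := by
        intro hv; exact h₁nz (by rw [hu, hv])
      refine ⟨v₂ / v₁, ?_, ?_⟩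
      · field_simp
        linear_combination -h0
      · field_simp
    · refine ⟨u₂ / u₁, ?_, ?_⟩
      · field_simp
      · field_simp
        linear_combination h0
  obtain ⟨p1, q1⟩ := inv_aux _ _ _ _ _ _ _ _ _ _ _ _ _ _ _ h₁nz h₁
  obtain ⟨p2, q2⟩ := inv_aux _ _ _ _ _ _ _ _ _ _ _ _ _ _ _ h₂nz h₂
  obtain ⟨m0, m1, A0, A1, A2, A3⟩ := fac_aux _ _ _ _ _ _ _ _ hd
    (inv_aux_C2 _ _ _ _ _ _ _ _ p1) (inv_aux_C2 _ _ _ _ _ _ _ _ p2)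
  obtain ⟨n0, n1, D0, D1, D2, D3⟩ := fac_aux _ _ _ _ _ _ _ _ hd
    (inv_aux_D _ _ _ _ _ _ _ _ _ _ _ _ _ _ q1) (inv_aux_D _ _ _ _ _ _ _ _ _ _ _ _ _ _ q2)
  apply MvPolynomial.map_injective (algebraMap ℝ ℂ) (algebraMap ℝ ℂ).injective
  have := B2_fac_aux ((-u₁) * (-u₂)) (-((-u₁) * v₂ + v₁ * (-u₂))) (v₁ * v₂) m0 m1 n0 n1
    (MvPolynomial.map (algebraMap ℝ ℂ) (C2poly a20 a11 a02 b20 b11 b02))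
    (MvPolynomial.map (algebraMap ℝ ℂ) (Dpoly a00 a10 a01 a20 a11 a02 b00 b10 b01 b20 b11 b02)) _
    (by rw [C2poly_cubAux, map_cubAux, A0, A1, A2, A3]; congr 1; ring)
    (by rw [Dpoly_cubAux, map_cubAux, D0, D1, D2, D3]; congr 1; ring) rfl
  rw [map_zero, ← this]
  simp only [B2poly, B3poly, transvectant2, transvectant3, map_add, map_sub, map_mul,
    ← pderiv_map, map_ofNat]
end
end

section
/- Let p2, q2 be real binary quadratic forms with (p2,q2) ≠ (0,0), and compute gcd(p2,q2) in ℂ[x,y]. Then: deg gcd(p2,q2) = 0 if and only if μ ≠ 0; deg gcd(p2,q2) = 1 if and only if μ = 0 and K ≠ 0; and deg gcd(p2,q2) = 2 if and only if K = 0 identically. -/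
open MvPolynomial

noncomputable section

/-- `K(x,y) = Jacobian(p₂,q₂) = (∂p₂/∂x)(∂q₂/∂y) − (∂p₂/∂y)(∂q₂/∂x)`. -/
def Kpoly (a20 a11 a02 b20 b11 b02 : ℝ) : MvPolynomial (Fin 2) ℝ :=
  pderiv 0 (quadForm a20 a11 a02) * pderiv 1 (quadForm b20 b11 b02)
    - pderiv 1 (quadForm a20 a11 a02) * pderiv 0 (quadForm b20 b11 b02)

/-- `μ`, the discriminant of the binary quadratic form `K = k1·x² + k2·xy + k3·y²`:
`μ = k2² − 4·k1·k3`. -/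
def muInv (a20 a11 a02 b20 b11 b02 : ℝ) : ℝ :=
  (coeffXY 1 1 (Kpoly a20 a11 a02 b20 b11 b02)) ^ 2
    - 4 * coeffXY 2 0 (Kpoly a20 a11 a02 b20 b11 b02)
        * coeffXY 0 2 (Kpoly a20 a11 a02 b20 b11 b02)

/-- `g` is a greatest common divisor of `f₁` and `f₂`. -/
def IsGcdOf (g f₁ f₂ : MvPolynomial (Fin 2) ℂ) : Prop :=
  g ∣ f₁ ∧ g ∣ f₂ ∧ ∀ d : MvPolynomial (Fin 2) ℂ, d ∣ f₁ → d ∣ f₂ → d ∣ g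

theorem aux_quad_mono (a b c : ℝ) : quadForm a b c =
    monomial (Finsupp.single 0 2 + Finsupp.single 1 0) a
    + monomial (Finsupp.single 0 1 + Finsupp.single 1 1) (2*b)
    + monomial (Finsupp.single 0 0 + Finsupp.single 1 2) c := by
  have e (i j : ℕ) (r : ℝ) : monomial (Finsupp.single (0 : Fin 2) i + Finsupp.single 1 j) r
      = C r * (X 0 ^ i * X 1 ^ j) := by
    rw [X_pow_eq_monomial, X_pow_eq_monomial, monomial_mul, C_mul_monomial]; simp
  rw [e, e, e, quadForm]; ring

theorem aux_ne (i j k l : ℕ) (h : i ≠ k) : (Finsupp.single (0 : Fin 2) i + Finsupp.single 1 j)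
    ≠ Finsupp.single 0 k + Finsupp.single 1 l := by
  intro h'
  have := DFunLike.congr_fun h' 0
  simp at this
  exact h this

theorem aux_c20 (a b c : ℝ) : coeffXY 2 0 (quadForm a b c) = a := by
  rw [coeffXY, aux_quad_mono, coeff_add, coeff_add, coeff_monomial, coeff_monomial, coeff_monomial,
    if_pos rfl, if_neg (aux_ne _ _ _ _ (by decide)), if_neg (aux_ne _ _ _ _ (by decide))]
  ring

theorem aux_c11 (a b c : ℝ) : coeffXY 1 1 (quadForm a b c) = 2 * b := by
  rw [coeffXY, aux_quad_mono, coeff_add, coeff_add, coeff_monomial, coeff_monomial, coeff_monomial,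
    if_pos rfl, if_neg (aux_ne _ _ _ _ (by decide)), if_neg (aux_ne _ _ _ _ (by decide))]
  ring

theorem aux_c02 (a b c : ℝ) : coeffXY 0 2 (quadForm a b c) = c := by
  rw [coeffXY, aux_quad_mono, coeff_add, coeff_add, coeff_monomial, coeff_monomial, coeff_monomial,
    if_pos rfl, if_neg (aux_ne _ _ _ _ (by decide)), if_neg (aux_ne _ _ _ _ (by decide))]
  ring

theorem aux_zero (a b c : ℝ) : quadForm a b c = 0 ↔ a = 0 ∧ b = 0 ∧ c = 0 := by
  constructor
  · intro h
    have h1 := aux_c20 a b c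
    have h2 := aux_c11 a b c
    have h3 := aux_c02 a b c
    rw [h] at h1 h2 h3
    simp [coeffXY] at h1 h2 h3
    exact ⟨h1.symm, h2, h3.symm⟩
  · rintro ⟨rfl, rfl, rfl⟩
    simp [quadForm]

theorem aux_K (a20 a11 a02 b20 b11 b02 : ℝ) : Kpoly a20 a11 a02 b20 b11 b02 =
    quadForm (4 * (a20 * b11 - a11 * b20)) (2 * (a20 * b02 - a02 * b20))
      (4 * (a11 * b02 - a02 * b11)) := by
  have h2 : (C 2 : MvPolynomial (Fin 2) ℝ) = 2 := rfl
  have h4 : (C 4 : MvPolynomial (Fin 2) ℝ) = 4 := rfl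
  have hz (i : Fin 2) : pderiv i (2 : MvPolynomial (Fin 2) ℝ) = 0 := by
    rw [← h2, pderiv_C]
  have p0 (a b c : ℝ) : pderiv 0 (quadForm a b c) = 2 * (C a * X 0 + C b * X 1) := by
    simp [quadForm, Derivation.leibniz, Derivation.leibniz_pow, pderiv_X, h2, hz]; ring
  have p1 (a b c : ℝ) : pderiv 1 (quadForm a b c) = 2 * (C b * X 0 + C c * X 1) := by
    simp [quadForm, Derivation.leibniz, Derivation.leibniz_pow, pderiv_X, h2, hz]; ring
  rw [Kpoly, p0, p0, p1, p1, quadForm]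
  simp only [C_mul, C_sub, h2, h4]
  ring

/-- complex linear form -/
def linC (a b : ℂ) : MvPolynomial (Fin 2) ℂ := C a * X 0 + C b * X 1

theorem aux_unit_X (n : ℕ) (d : MvPolynomial (Fin 2) ℂ) (h0 : d ∣ X 0 ^ n) (h1 : d ∣ X 1 ^ n) :
    IsUnit d := by
  have hp : IsRelPrime (X 0 ^ n : MvPolynomial (Fin 2) ℂ) (X 1 ^ n) := by
    apply IsRelPrime.pow
    rw [(MvPolynomial.X_prime (R := ℂ) (i := (0 : Fin 2))).irreducible.isRelPrime_iff_not_dvd]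
    rw [X_dvd_X]
    simp
  exact hp h0 h1

theorem aux_deg_unit (d : MvPolynomial (Fin 2) ℂ) (h : IsUnit d) : d.totalDegree = 0 := by
  rw [MvPolynomial.isUnit_iff_totalDegree_of_isReduced] at h
  exact h.2

theorem aux_dvd_C (c : ℂ) (hc : c ≠ 0) (d f : MvPolynomial (Fin 2) ℂ) (h : d ∣ C c * f) :
    d ∣ f := by
  have : f = C c⁻¹ * (C c * f) := by
    rw [← mul_assoc, ← C_mul, inv_mul_cancel₀ hc]; simp
  rw [this]
  exact h.mul_left _

theorem aux_map (a b c : ℝ) : MvPolynomial.map (algebraMap ℝ ℂ) (quadForm a b c) =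
    C (a:ℂ) * X 0 ^ 2 + 2 * C (b:ℂ) * (X 0 * X 1) + C (c:ℂ) * X 1 ^ 2 := by
  have h2 : (C 2 : MvPolynomial (Fin 2) ℂ) = 2 := rfl
  simp [quadForm, h2]

theorem aux_lin_deg (a b : ℂ) (h : linC a b ≠ 0) : (linC a b).totalDegree = 1 := by
  have : (linC a b).IsHomogeneous 1 := by
    unfold linC
    exact ((isHomogeneous_C_mul_X a 0).add (isHomogeneous_C_mul_X b 1))
  exact this.totalDegree h

theorem aux_quad_deg (a b c : ℝ) (h : quadForm a b c ≠ 0) :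
    (MvPolynomial.map (algebraMap ℝ ℂ) (quadForm a b c)).totalDegree = 2 := by
  have h1 : (quadForm a b c).IsHomogeneous 2 := by
    rw [aux_quad_mono]
    refine ((isHomogeneous_monomial _ ?_).add (isHomogeneous_monomial _ ?_)).add
      (isHomogeneous_monomial _ ?_) <;> simp [map_add]
  apply (h1.map (algebraMap ℝ ℂ)).totalDegree
  intro h0
  apply h
  apply MvPolynomial.map_injective (algebraMap ℝ ℂ) (algebraMap ℝ ℂ).injective
  rw [h0, map_zero]

theorem aux_assoc_deg {f g : MvPolynomial (Fin 2) ℂ} (h1 : f ∣ g) (h2 : g ∣ f) (hf : f ≠ 0) :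
    g.totalDegree = f.totalDegree := by
  have hg : g ≠ 0 := by rintro rfl; exact hf (zero_dvd_iff.mp h2)
  apply le_antisymm
  · exact totalDegree_le_of_dvd_of_isDomain h2 hf
  · exact totalDegree_le_of_dvd_of_isDomain h1 hg

/-- degree one case -/
theorem aux_one (g P Q : MvPolynomial (Fin 2) ℂ) (hg : IsGcdOf g P Q) (t l1 l2 m1 m2 n1 n2 : ℂ)
    (ht : t ≠ 0) (hP : C t * P = linC l1 l2 * linC m1 m2) (hQ : C t * Q = linC l1 l2 * linC n1 n2)
    (hd : m1 * n2 - m2 * n1 ≠ 0) (hl : linC l1 l2 ≠ 0) : g.totalDegree = 1 := by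
  obtain ⟨g1, g2, g3⟩ := hg
  obtain ⟨h, rfl⟩ := g3 (linC l1 l2) (aux_dvd_C t ht _ _ ⟨_, hP⟩) (aux_dvd_C t ht _ _ ⟨_, hQ⟩)
  have k1 : h ∣ linC m1 m2 := by
    have := g1.mul_left (C t)
    rw [hP] at this
    exact (mul_dvd_mul_iff_left hl).mp this
  have k2 : h ∣ linC n1 n2 := by
    have := g2.mul_left (C t)
    rw [hQ] at this
    exact (mul_dvd_mul_iff_left hl).mp this
  have hu : IsUnit h := by
    apply aux_unit_X 1
    · apply aux_dvd_C _ hd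
      have := dvd_sub (k1.mul_left (C n2)) (k2.mul_left (C m2))
      convert this using 1
      simp only [linC, C_sub, C_mul]; ring
    · apply aux_dvd_C _ hd
      have := dvd_sub (k2.mul_left (C m1)) (k1.mul_left (C n1))
      convert this using 1
      simp only [linC, C_sub, C_mul]; ring
  rw [totalDegree_mul_of_isDomain hl hu.ne_zero, aux_deg_unit _ hu, aux_lin_deg _ _ hl]

theorem aux_lin_ne (a b : ℂ) (h : a ≠ 0 ∨ b ≠ 0) : linC a b ≠ 0 := by
  intro h0
  have e1 := congrArg (MvPolynomial.eval ![1, 0]) h0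
  have e2 := congrArg (MvPolynomial.eval ![0, 1]) h0
  simp [linC] at e1 e2
  tauto

theorem aux_ofReal_sq (t : ℝ) (ht : t ≠ 0) : (4 * (t:ℂ)^2) ≠ 0 := by
  simp [ht]

theorem aux_case_B (a20 a11 a02 b20 b11 b02 : ℝ) (g : MvPolynomial (Fin 2) ℂ)
    (hg : IsGcdOf g (MvPolynomial.map (algebraMap ℝ ℂ) (quadForm a20 a11 a02))
                    (MvPolynomial.map (algebraMap ℝ ℂ) (quadForm b20 b11 b02)))
    (A B D : ℝ) (hA : A = a20 * b11 - a11 * b20) (hB : B = a20 * b02 - a02 * b20)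
    (hD : D = a11 * b02 - a02 * b11)
    (hmu : B ^ 2 = 4 * A * D) (hK : A ≠ 0 ∨ D ≠ 0) : g.totalDegree = 1 := by
  have pa : a20 * D - a11 * B + a02 * A = 0 := by subst hA hB hD; ring
  have pb : b20 * D - b11 * B + b02 * A = 0 := by subst hA hB hD; ring
  have h2 : (C 2 : MvPolynomial (Fin 2) ℂ) = 2 := rfl
  have h4 : (C 4 : MvPolynomial (Fin 2) ℂ) = 4 := rfl
  have hmu' := congrArg (fun r : ℝ => (C (r:ℂ) : MvPolynomial (Fin 2) ℂ)) hmu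
  have pa' := congrArg (fun r : ℝ => (C (r:ℂ) : MvPolynomial (Fin 2) ℂ)) pa
  have pb' := congrArg (fun r : ℝ => (C (r:ℂ) : MvPolynomial (Fin 2) ℂ)) pb
  push_cast at hmu' pa' pb'
  simp only [C_mul, C_sub, C_add, C_pow, h2, h4, C_0] at hmu' pa' pb'
  rcases hK with h | h
  · refine aux_one g _ _ hg (4 * (A:ℂ)^2) (2*A) B (2*A*a20) (4*A*a11-B*a20)
      (2*A*b20) (4*A*b11-B*b20) (aux_ofReal_sq A h) ?_ ?_ ?_ ?_
    · rw [aux_map]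
      simp only [linC, C_mul, C_sub, C_add, C_pow, h2, h4]
      linear_combination (X 1 ^ 2 * C (a20:ℂ)) * hmu' + 4 * C (A:ℂ) * X 1 ^ 2 * pa'
    · rw [aux_map]
      simp only [linC, C_mul, C_sub, C_add, C_pow, h2, h4]
      linear_combination (X 1 ^ 2 * C (b20:ℂ)) * hmu' + 4 * C (A:ℂ) * X 1 ^ 2 * pb'
    · have : (2*A*a20) * (4*A*b11-B*b20) - (4*A*a11-B*a20) * (2*A*b20) = 8 * A ^ 3 := by
        linear_combination (-8*A^2) * hA
      have t : (8 * A^3) ≠ 0 := by positivity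
      rw [← this] at t
      exact_mod_cast t
    · apply aux_lin_ne; left; simp [h]
  · refine aux_one g _ _ hg (4 * (D:ℂ)^2) B (2*D) (4*D*a11-B*a02) (2*D*a02)
      (4*D*b11-B*b02) (2*D*b02) (aux_ofReal_sq D h) ?_ ?_ ?_ ?_
    · rw [aux_map]
      simp only [linC, C_mul, C_sub, C_add, C_pow, h2, h4]
      linear_combination (X 0 ^ 2 * C (a02:ℂ)) * hmu' + 4 * C (D:ℂ) * X 0 ^ 2 * pa'
    · rw [aux_map]
      simp only [linC, C_mul, C_sub, C_add, C_pow, h2, h4]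
      linear_combination (X 0 ^ 2 * C (b02:ℂ)) * hmu' + 4 * C (D:ℂ) * X 0 ^ 2 * pb'
    · have : (4*D*a11-B*a02) * (2*D*b02) - (2*D*a02) * (4*D*b11-B*b02) = 8 * D ^ 3 := by
        linear_combination (-8*D^2) * hD
      have t : (8 * D^3) ≠ 0 := by positivity
      rw [← this] at t
      exact_mod_cast t
    · apply aux_lin_ne; right; simp [h]

theorem aux_case_C (a20 a11 a02 b20 b11 b02 : ℝ) (g : MvPolynomial (Fin 2) ℂ)
    (hg : IsGcdOf g (MvPolynomial.map (algebraMap ℝ ℂ) (quadForm a20 a11 a02))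
                    (MvPolynomial.map (algebraMap ℝ ℂ) (quadForm b20 b11 b02)))
    (hmu : (a20 * b02 - a02 * b20) ^ 2 - 4 * (a20 * b11 - a11 * b20) * (a11 * b02 - a02 * b11) ≠ 0) :
    g.totalDegree = 0 := by
  obtain ⟨g1, g2, -⟩ := hg
  rw [aux_map] at g1 g2
  have h2 : (C 2 : MvPolynomial (Fin 2) ℂ) = 2 := rfl
  have h4 : (C 4 : MvPolynomial (Fin 2) ℂ) = 4 := rfl
  have hmu' : ((a20:ℂ) * b02 - a02 * b20) ^ 2
    - 4 * (a20 * b11 - a11 * b20) * (a11 * b02 - a02 * b11) ≠ 0 := by exact_mod_cast hmu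
  apply aux_deg_unit
  apply aux_unit_X 3
  · apply aux_dvd_C _ hmu'
    have := dvd_sub
      (g1.mul_left (linC (b02 * (a20 * b02 - a02 * b20) - 4 * b11 * (a11 * b02 - a02 * b11))
        (-2 * b02 * (a11 * b02 - a02 * b11))))
      (g2.mul_left (linC (a02 * (a20 * b02 - a02 * b20) - 4 * a11 * (a11 * b02 - a02 * b11))
        (-2 * a02 * (a11 * b02 - a02 * b11))))
    convert this using 1
    simp only [linC, C_mul, C_sub, C_add, C_pow, C_neg, h2, h4]
    ring
  · apply aux_dvd_C _ hmu'
    have := dvd_sub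
      (g2.mul_left (linC (-2 * a20 * (a20 * b11 - a11 * b20))
        (a20 * (a20 * b02 - a02 * b20) - 4 * a11 * (a20 * b11 - a11 * b20))))
      (g1.mul_left (linC (-2 * b20 * (a20 * b11 - a11 * b20))
        (b20 * (a20 * b02 - a02 * b20) - 4 * b11 * (a20 * b11 - a11 * b20))))
    convert this using 1
    simp only [linC, C_mul, C_sub, C_add, C_pow, C_neg, h2, h4]
    ring

theorem aux_prop (a b c a' b' c' : ℝ) (h : quadForm a b c ≠ 0) (h1 : a * b' - b * a' = 0)
    (h2 : a * c' - c * a' = 0) (h3 : b * c' - c * b' = 0) :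
    MvPolynomial.map (algebraMap ℝ ℂ) (quadForm a b c) ∣
      MvPolynomial.map (algebraMap ℝ ℂ) (quadForm a' b' c') := by
  apply map_dvd
  have key : ∃ k, a' = a * k ∧ b' = b * k ∧ c' = c * k := by
    by_cases ha : a = 0
    · by_cases hb : b = 0
      · by_cases hc : c = 0
        · exact absurd ((aux_zero a b c).2 ⟨ha, hb, hc⟩) h
        · refine ⟨c' / c, ?_, ?_, ?_⟩ <;> field_simp <;> linarith
      · refine ⟨b' / b, ?_, ?_, ?_⟩ <;> field_simp <;> linarith
    · refine ⟨a' / a, ?_, ?_, ?_⟩ <;> field_simp <;> linarith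
  obtain ⟨k, rfl, rfl, rfl⟩ := key
  refine ⟨C k, ?_⟩
  simp only [quadForm, C_mul]
  ring

/-- For real binary quadratic forms `p₂, q₂` with `(p₂,q₂) ≠ (0,0)` and any gcd `g` of
them in `ℂ[x,y]`:  `deg g = 0 ↔ μ ≠ 0`;  `deg g = 1 ↔ (μ = 0 ∧ K ≠ 0)`;  and
`deg g = 2 ↔ K = 0`. -/
theorem deg_gcd_of_quadratic_parts
    (a20 a11 a02 b20 b11 b02 : ℝ)
    (hnz : ¬ (quadForm a20 a11 a02 = 0 ∧ quadForm b20 b11 b02 = 0))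
    (g : MvPolynomial (Fin 2) ℂ)
    (hg : IsGcdOf g (MvPolynomial.map (algebraMap ℝ ℂ) (quadForm a20 a11 a02))
                    (MvPolynomial.map (algebraMap ℝ ℂ) (quadForm b20 b11 b02))) :
    (g.totalDegree = 0 ↔ muInv a20 a11 a02 b20 b11 b02 ≠ 0) ∧
    (g.totalDegree = 1 ↔
      (muInv a20 a11 a02 b20 b11 b02 = 0 ∧ Kpoly a20 a11 a02 b20 b11 b02 ≠ 0)) ∧
    (g.totalDegree = 2 ↔ Kpoly a20 a11 a02 b20 b11 b02 = 0) := by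
  have case_A : Kpoly a20 a11 a02 b20 b11 b02 = 0 → g.totalDegree = 2 := by
    intro hK
    rw [aux_K, aux_zero] at hK
    obtain ⟨k1, k2, k3⟩ := hK
    obtain ⟨g1, g2, g3⟩ := hg
    by_cases hP : quadForm a20 a11 a02 = 0
    · have hQ : quadForm b20 b11 b02 ≠ 0 := fun h => hnz ⟨hP, h⟩
      have hd := aux_quad_deg _ _ _ hQ
      have := g3 _ (aux_prop b20 b11 b02 a20 a11 a02 hQ (by linarith) (by linarith) (by linarith))
        dvd_rfl
      rw [aux_assoc_deg this g2 (by intro h; rw [h] at hd; simp at hd), hd]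
    · have hd := aux_quad_deg _ _ _ hP
      have := g3 _ dvd_rfl
        (aux_prop a20 a11 a02 b20 b11 b02 hP (by linarith) (by linarith) (by linarith))
      rw [aux_assoc_deg this g1 (by intro h; rw [h] at hd; simp at hd), hd]
  have hmu : muInv a20 a11 a02 b20 b11 b02 = 16 * ((a20 * b02 - a02 * b20) ^ 2
      - 4 * (a20 * b11 - a11 * b20) * (a11 * b02 - a02 * b11)) := by
    rw [muInv, aux_K, aux_c20, aux_c11, aux_c02]; ring
  have case_C : muInv a20 a11 a02 b20 b11 b02 ≠ 0 → g.totalDegree = 0 := by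
    intro h
    apply aux_case_C a20 a11 a02 b20 b11 b02 g hg
    intro h0
    rw [hmu, h0] at h
    simp at h
  have case_B : muInv a20 a11 a02 b20 b11 b02 = 0 → Kpoly a20 a11 a02 b20 b11 b02 ≠ 0 →
      g.totalDegree = 1 := by
    intro h hK
    rw [hmu] at h
    refine aux_case_B a20 a11 a02 b20 b11 b02 g hg _ _ _ rfl rfl rfl (by linarith) ?_
    by_contra! hc
    apply hK
    rw [aux_K, aux_zero]
    rw [hc.1, hc.2] at h ⊢
    simpa using h
  have hKm : Kpoly a20 a11 a02 b20 b11 b02 = 0 → muInv a20 a11 a02 b20 b11 b02 = 0 := by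
    intro h
    simp [muInv, h, coeffXY]
  by_cases h1 : Kpoly a20 a11 a02 b20 b11 b02 = 0
  · have := case_A h1
    have := hKm h1
    simp_all
  · by_cases h2 : muInv a20 a11 a02 b20 b11 b02 = 0
    · have := case_B h2 h1
      simp_all
    · have := case_C h2
      simp_all
end
end

section
/- If a quadratic differential system possesses one couple of distinct parallel invariant affine lines (two invariant lines ux+vy+w₁ = 0, ux+vy+w₂ = 0 with the same (u,v) ≠ (0,0) and w₁ ≠ w₂, coefficients in ℂ), then θ = 0. -/
open MvPolynomial

noncomputable section

/-- `H(x,y) = 4[(b20·x − a20·y)(b02·x − a02·y) − (b11·x − a11·y)²]`. -/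
def Hpoly (a20 a11 a02 b20 b11 b02 : ℝ) : MvPolynomial (Fin 2) ℝ :=
  4 * ((C b20 * X 0 - C a20 * X 1) * (C b02 * X 0 - C a02 * X 1)
        - (C b11 * X 0 - C a11 * X 1) ^ 2)

/-- `N(x,y) = K(x,y) + H(x,y)`. -/
def Npoly (a20 a11 a02 b20 b11 b02 : ℝ) : MvPolynomial (Fin 2) ℝ :=
  Kpoly a20 a11 a02 b20 b11 b02 + Hpoly a20 a11 a02 b20 b11 b02

/-- `θ`, the discriminant of the binary quadratic form `N = n1·x² + n2·xy + n3·y²`: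
`θ = n2² − 4·n1·n3`. -/
def thetaInv (a20 a11 a02 b20 b11 b02 : ℝ) : ℝ :=
  (coeffXY 1 1 (Npoly a20 a11 a02 b20 b11 b02)) ^ 2
    - 4 * coeffXY 2 0 (Npoly a20 a11 a02 b20 b11 b02)
        * coeffXY 0 2 (Npoly a20 a11 a02 b20 b11 b02)

theorem aux_eval (a00 a10 a01 a20 a11 a02 b00 b10 b01 b20 b11 b02 : ℝ) (u v w : ℂ)
    (h : IsInvLine (quadPoly a00 a10 a01 a20 a11 a02)
                    (quadPoly b00 b10 b01 b20 b11 b02) u v w) (x y : ℂ)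
    (hxy : u * x + v * y + w = 0) :
    (a00 + a10 * x + a01 * y + a20 * x ^ 2 + 2 * a11 * (x * y) + a02 * y ^ 2) * u +
    (b00 + b10 * x + b01 * y + b20 * x ^ 2 + 2 * b11 * (x * y) + b02 * y ^ 2) * v = 0 := by
  obtain ⟨k, hk⟩ := h
  have := congrArg (MvPolynomial.eval ![x, y]) hk
  simp [linePoly, quadPoly, pderiv_X, hxy] at this
  linear_combination this

theorem aux_theta (a20 a11 a02 b20 b11 b02 : ℝ) :
    thetaInv a20 a11 a02 b20 b11 b02 =
      16 * ((2 * a11 * b11 - 2 * a02 * b20) ^ 2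
        - 4 * (a20 * b11 - a11 * b20 + b20 * b02 - b11 ^ 2)
          * (a11 * b02 - a02 * b11 + a20 * a02 - a11 ^ 2)) := by
  have hN : Npoly a20 a11 a02 b20 b11 b02 =
      monomial (Finsupp.single (0 : Fin 2) 2 + Finsupp.single (1 : Fin 2) 0)
        (4 * (a20 * b11 - a11 * b20 + b20 * b02 - b11 ^ 2)) +
      monomial (Finsupp.single (0 : Fin 2) 1 + Finsupp.single (1 : Fin 2) 1)
        (4 * (2 * a11 * b11 - 2 * a02 * b20)) +
      monomial (Finsupp.single (0 : Fin 2) 0 + Finsupp.single (1 : Fin 2) 2)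
        (4 * (a11 * b02 - a02 * b11 + a20 * a02 - a11 ^ 2)) := by
    apply MvPolynomial.funext
    intro z
    simp [Npoly, Kpoly, Hpoly, quadForm, pderiv_X, eval_monomial, Finsupp.prod_fintype]
    ring
  have e (i j k l : ℕ) : (Finsupp.single (0 : Fin 2) i + Finsupp.single (1 : Fin 2) j =
      Finsupp.single (0 : Fin 2) k + Finsupp.single (1 : Fin 2) l) ↔ (i = k ∧ j = l) := by
    simp [Finsupp.ext_iff]
  simp only [thetaInv, coeffXY, hN, coeff_add, coeff_monomial, e]
  norm_num
  ring

theorem aux_alg (g0 g10 g01 g20 g11 g02 u v w₁ w₂ : ℂ) (hu : u ≠ 0) (hw : w₁ ≠ w₂)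
    (h₁ : ∀ x y, u * x + v * y + w₁ = 0 →
      g0 + g10 * x + g01 * y + g20 * x ^ 2 + 2 * g11 * (x * y) + g02 * y ^ 2 = 0)
    (h₂ : ∀ x y, u * x + v * y + w₂ = 0 →
      g0 + g10 * x + g01 * y + g20 * x ^ 2 + 2 * g11 * (x * y) + g02 * y ^ 2 = 0) :
    g11 = g20 * (v / u) ∧ g02 = g20 * (v / u) ^ 2 := by
  obtain ⟨m, rfl⟩ : ∃ m, v = m * u := ⟨v / u, by field_simp⟩
  obtain ⟨s, rfl⟩ : ∃ s, w₁ = s * u := ⟨w₁ / u, by field_simp⟩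
  obtain ⟨r, rfl⟩ : ∃ r, w₂ = r * u := ⟨w₂ / u, by field_simp⟩
  have hsr : s - r ≠ 0 := fun h => hw (by rw [sub_eq_zero.1 h])
  have A := h₁ (-s - m) 1 (by ring)
  have B := h₁ (-s + m) (-1) (by ring)
  have Z := h₁ (-s) 0 (by ring)
  have A' := h₂ (-r - m) 1 (by ring)
  have B' := h₂ (-r + m) (-1) (by ring)
  rw [mul_div_cancel_right₀ _ hu]
  have E : g11 = g20 * m := by
    apply mul_left_cancel₀ hsr
    linear_combination (-1/4) * (A - B - A' + B')
  refine ⟨E, ?_⟩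
  linear_combination (1/2) * (A + B - 2 * Z) + 2 * m * E

/-- If a quadratic differential system possesses one couple of distinct parallel
invariant affine lines, then `θ = 0`. -/
theorem theta_vanishes_of_parallel_lines
    (a00 a10 a01 a20 a11 a02 b00 b10 b01 b20 b11 b02 : ℝ)
    (hdeg : ¬ (a20 = 0 ∧ a11 = 0 ∧ a02 = 0 ∧ b20 = 0 ∧ b11 = 0 ∧ b02 = 0))
    (u v w₁ w₂ : ℂ) (huv : (u, v) ≠ (0, 0)) (hw : w₁ ≠ w₂)
    (h₁ : IsInvLine (quadPoly a00 a10 a01 a20 a11 a02)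
                    (quadPoly b00 b10 b01 b20 b11 b02) u v w₁)
    (h₂ : IsInvLine (quadPoly a00 a10 a01 a20 a11 a02)
                    (quadPoly b00 b10 b01 b20 b11 b02) u v w₂) :
    thetaInv a20 a11 a02 b20 b11 b02 = 0 := by
  rw [aux_theta]
  have e₁ := aux_eval _ _ _ _ _ _ _ _ _ _ _ _ _ _ _ h₁
  have e₂ := aux_eval _ _ _ _ _ _ _ _ _ _ _ _ _ _ _ h₂
  have key : ∀ z : ℝ, (z : ℂ) = 0 → z = 0 := fun z h => by exact_mod_cast h
  apply key
  push_cast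
  by_cases hu : u = 0
  · have hv : v ≠ 0 := fun hv => huv (by rw [hu, hv])
    subst hu
    obtain ⟨E, F⟩ := aux_alg (b00 * v) (b01 * v) (b10 * v) (b02 * v) (b11 * v) (b20 * v)
      v 0 w₁ w₂ hv hw
      (fun y x h => by linear_combination e₁ x y (by linear_combination h))
      (fun y x h => by linear_combination e₂ x y (by linear_combination h))
    have E' : (b11 : ℂ) = 0 := by simpa [hv] using E
    have F' : (b20 : ℂ) = 0 := by simpa [hv] using F
    rw [E', F']
    ring
  · obtain ⟨E, F⟩ := aux_alg (a00 * u + b00 * v) (a10 * u + b10 * v) (a01 * u + b01 * v)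
      (a20 * u + b20 * v) (a11 * u + b11 * v) (a02 * u + b02 * v) u v w₁ w₂ hu hw
      (fun x y h => by linear_combination e₁ x y h)
      (fun x y h => by linear_combination e₂ x y h)
    obtain ⟨m, rfl⟩ : ∃ m, v = m * u := ⟨v / u, by field_simp⟩
    rw [mul_div_cancel_right₀ _ hu] at E F
    obtain ⟨L, hL⟩ : ∃ L : ℂ, (a20 : ℂ) = L - b20 * m := ⟨a20 + b20 * m, by ring⟩
    have E' : (a11 : ℂ) = L * m - b11 * m := by
      apply mul_right_cancel₀ hu
      rw [hL] at E
      linear_combination E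
    have F' : (a02 : ℂ) = L * m ^ 2 - b02 * m := by
      apply mul_right_cancel₀ hu
      rw [hL] at F
      linear_combination F
    rw [hL, E', F']
    ring
end
end

section
/- Let ẋ = p(x,y), ẏ = q(x,y) be a quadratic differential system with gcd(p,q) = 1. A straight line L(x,y) = ux + vy + w = 0 with u,v,w ∈ ℂ, (u,v) ≠ (0,0), is an invariant line of the system if and only if the polynomial ux + vy + w is a common factor of Ẽ1 and Ẽ2 over ℂ, i.e., (ux+vy+w) divides Ẽ1(x,y) and divides Ẽ2(x,y) in ℂ[x,y]. -/
open MvPolynomial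

noncomputable section

/-- `Ẽ1(x,y) = Γ1(x,y)` where `Γ1(x₀,y₀) = Res_{x'}(C̃1,C̃0)/(y')²` for the translated
system; explicitly `Ẽ1 = p_y·q² + (p_x − q_y)·p·q − q_x·p²` (partial derivatives of the
system evaluated at `(x,y)`). -/
def Etilde1 (p q : MvPolynomial (Fin 2) ℝ) : MvPolynomial (Fin 2) ℝ :=
  pderiv 1 p * q ^ 2 + (pderiv 0 p - pderiv 1 q) * (p * q) - pderiv 0 q * p ^ 2

/-- `Ẽ2(x,y) = Γ2(x,y)` where `Γ2(x₀,y₀) = Res_{x'}(C̃2,C̃0)/(y')³`; explicitly `Ẽ2` is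
the binary cubic `C2(x,y) = y·p₂ − x·q₂` evaluated at `(p(x,y), q(x,y))`. -/
def Etilde2 (p q : MvPolynomial (Fin 2) ℝ) : MvPolynomial (Fin 2) ℝ :=
  MvPolynomial.aeval ![p, q]
    (X 1 * MvPolynomial.homogeneousComponent 2 p
      - X 0 * MvPolynomial.homogeneousComponent 2 q)


lemma aux_tdeg (p : MvPolynomial (Fin 2) ℝ) :
    (MvPolynomial.map (algebraMap ℝ ℂ) p).totalDegree = p.totalDegree := by
  rw [totalDegree, totalDegree, support_map_of_injective p (algebraMap ℝ ℂ).injective]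

lemma aux_decomp (D : MvPolynomial (Fin 2) ℂ) : ∃ A B : MvPolynomial (Fin 2) ℝ,
    D = MvPolynomial.map (algebraMap ℝ ℂ) A + C Complex.I * MvPolynomial.map (algebraMap ℝ ℂ) B := by
  induction D using MvPolynomial.induction_on with
  | C a =>
    refine ⟨C a.re, C a.im, ?_⟩
    rw [map_C, map_C, ← C_mul, ← C_add]
    congr 1
    apply Complex.ext <;> simp
  | add p q hp hq =>
    obtain ⟨A, B, rfl⟩ := hp
    obtain ⟨A', B', rfl⟩ := hq
    exact ⟨A + A', B + B', by simp only [map_add]; ring⟩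
  | mul_X p i hp =>
    obtain ⟨A, B, rfl⟩ := hp
    exact ⟨A * X i, B * X i, by simp only [map_mul, map_X]; ring⟩

lemma aux_unique (A B : MvPolynomial (Fin 2) ℝ)
    (h : MvPolynomial.map (algebraMap ℝ ℂ) A + C Complex.I * MvPolynomial.map (algebraMap ℝ ℂ) B = 0) :
    A = 0 ∧ B = 0 := by
  have key : ∀ m, coeff m A = 0 ∧ coeff m B = 0 := by
    intro m
    have := congrArg (coeff m) h
    rw [coeff_add, coeff_C_mul, coeff_map, coeff_map, coeff_zero] at this
    have h1 := congrArg Complex.re this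
    have h2 := congrArg Complex.im this
    simp at h1 h2
    exact ⟨h1, h2⟩
  exact ⟨by ext m; simpa using (key m).1, by ext m; simpa using (key m).2⟩

lemma aux_Isq : (C Complex.I * C Complex.I : MvPolynomial (Fin 2) ℂ) = -1 := by
  rw [← C_mul, Complex.I_mul_I]; simp

lemma aux_norm_dvd (A B p : MvPolynomial (Fin 2) ℝ)
    (h : MvPolynomial.map (algebraMap ℝ ℂ) A + C Complex.I * MvPolynomial.map (algebraMap ℝ ℂ) B ∣
      MvPolynomial.map (algebraMap ℝ ℂ) p) : A ^ 2 + B ^ 2 ∣ p ^ 2 := by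
  obtain ⟨E, hE⟩ := h
  obtain ⟨A', B', rfl⟩ := aux_decomp E
  have := aux_unique (A * A' - B * B' - p) (A * B' + B * A') (by
    simp only [map_add, map_sub, map_mul]
    rw [hE]
    linear_combination (-(MvPolynomial.map (algebraMap ℝ ℂ) B) * (MvPolynomial.map (algebraMap ℝ ℂ) B')) * aux_Isq)
  obtain ⟨h1, h2⟩ := this
  refine ⟨A' ^ 2 + B' ^ 2, ?_⟩
  linear_combination (-(A * A' - B * B') - p) * h1 - (A * B' + B * A') * h2

lemma aux_coprime (p q : MvPolynomial (Fin 2) ℝ)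
    (hgcd : ∀ d : MvPolynomial (Fin 2) ℝ, d ∣ p → d ∣ q → IsUnit d)
    (D : MvPolynomial (Fin 2) ℂ) (hp : D ∣ MvPolynomial.map (algebraMap ℝ ℂ) p)
    (hq : D ∣ MvPolynomial.map (algebraMap ℝ ℂ) q) : IsUnit D := by
  obtain ⟨A, B, rfl⟩ := aux_decomp D
  have h1 := aux_norm_dvd A B p hp
  have h2 := aux_norm_dvd A B q hq
  have hrel : IsRelPrime p q := fun d => hgcd d
  have hu : IsUnit (A ^ 2 + B ^ 2) := (hrel.pow : IsRelPrime (p ^ 2) (q ^ 2)) h1 h2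
  have hu' := hu.map (MvPolynomial.map (algebraMap ℝ ℂ) : MvPolynomial (Fin 2) ℝ →+* _)
  refine isUnit_of_dvd_unit ⟨MvPolynomial.map (algebraMap ℝ ℂ) A - C Complex.I * MvPolynomial.map (algebraMap ℝ ℂ) B, ?_⟩ hu'
  simp only [map_add, map_pow]
  linear_combination ((MvPolynomial.map (algebraMap ℝ ℂ) B) ^ 2) * aux_Isq

lemma aux_form (p : MvPolynomial (Fin 2) ℝ) (h : p.totalDegree ≤ 2) :
    ∃ c0 c1 c2 c3 c4 c5 : ℝ, p = C c0 + C c1 * X 0 + C c2 * X 1 + C c3 * X 0 ^ 2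
      + C c4 * (X 0 * X 1) + C c5 * X 1 ^ 2 := by
  let f : ℕ × ℕ → (Fin 2 →₀ ℕ) := fun ij => Finsupp.single 0 ij.1 + Finsupp.single 1 ij.2
  have hf : Function.Injective f := by
    rintro ⟨a, b⟩ ⟨c, d⟩ hab
    have h0 := DFunLike.congr_fun hab 0
    have h1 := DFunLike.congr_fun hab 1
    simp [f] at h0 h1
    simp [h0, h1]
  let T : Finset (ℕ × ℕ) := {(0,0),(1,0),(0,1),(2,0),(1,1),(0,2)}
  have hs : p.support ⊆ T.image f := by
    intro m hm
    have hd := (le_totalDegree hm).trans h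
    rw [Finsupp.sum_fintype _ _ (by simp)] at hd
    simp at hd
    refine Finset.mem_image.2 ⟨(m 0, m 1), ?_, ?_⟩
    · have : (m 0 = 0 ∧ m 1 = 0) ∨ (m 0 = 1 ∧ m 1 = 0) ∨ (m 0 = 0 ∧ m 1 = 1) ∨
        (m 0 = 2 ∧ m 1 = 0) ∨ (m 0 = 1 ∧ m 1 = 1) ∨ (m 0 = 0 ∧ m 1 = 2) := by omega
      simpa [T] using this
    · ext i
      fin_cases i <;> simp [f]
  have hp : p = ∑ ij ∈ T, monomial (f ij) (coeff (f ij) p) := by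
    rw [← Finset.sum_image (f := fun m => monomial m (coeff m p)) (fun a _ b _ hab => hf hab)]
    conv_lhs => rw [p.as_sum]
    refine Finset.sum_subset hs ?_
    intro m _ hm
    rw [notMem_support_iff.1 hm, map_zero]
  have hmon : ∀ i j (a : ℝ), monomial (f (i, j)) a = C a * (X 0 ^ i * X 1 ^ j) := by
    intro i j a
    simp only [f, X_pow_eq_monomial, monomial_mul, C_mul_monomial, mul_one]
  refine ⟨coeff (f (0,0)) p, coeff (f (1,0)) p, coeff (f (0,1)) p, coeff (f (2,0)) p,
    coeff (f (1,1)) p, coeff (f (0,2)) p, ?_⟩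
  conv_lhs => rw [hp]
  simp only [T]
  repeat rw [Finset.sum_insert (by decide)]
  rw [Finset.sum_singleton]
  simp only [hmon]
  ring

lemma aux_hom (c0 c1 c2 c3 c4 c5 : ℝ) :
    homogeneousComponent 2 (C c0 + C c1 * X 0 + C c2 * X 1 + C c3 * X 0 ^ 2
      + C c4 * (X 0 * X 1) + C c5 * X 1 ^ 2 : MvPolynomial (Fin 2) ℝ)
      = C c3 * X 0 ^ 2 + C c4 * (X 0 * X 1) + C c5 * X 1 ^ 2 := by
  have h0 : homogeneousComponent 2 (C c0 : MvPolynomial (Fin 2) ℝ) = 0 := by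
    rw [homogeneousComponent_of_mem (isHomogeneous_C _ c0)]; simp
  have h1 : ∀ i : Fin 2, homogeneousComponent 2 (X i : MvPolynomial (Fin 2) ℝ) = 0 := by
    intro i
    rw [homogeneousComponent_of_mem (isHomogeneous_X _ i)]; simp
  have h2 : ∀ i : Fin 2, homogeneousComponent 2 (X i ^ 2 : MvPolynomial (Fin 2) ℝ) = X i ^ 2 := by
    intro i
    rw [homogeneousComponent_of_mem (isHomogeneous_X_pow i 2)]; simp
  have h3 : homogeneousComponent 2 (X 0 * X 1 : MvPolynomial (Fin 2) ℝ) = X 0 * X 1 := by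
    rw [homogeneousComponent_of_mem ((isHomogeneous_X _ 0).mul (isHomogeneous_X _ 1))]; simp
  simp only [map_add, homogeneousComponent_C_mul, h0, h1, h2, h3]
  ring

/-- change of frame for one quadratic polynomial -/
lemma aux_frame (u v w u' v' : ℂ) (hdet : u' * v - v' * u = 1) (c0 c1 c2 c3 c4 c5 : ℂ) :
    ∃ a0 a1 a2 a3 a4 a5 : ℂ,
      (∀ M L : MvPolynomial (Fin 2) ℂ, M = C u' * X 0 + C v' * X 1 → L = linePoly u v w →
      C c0 + C c1 * X 0 + C c2 * X 1 + C c3 * X 0 ^ 2 + C c4 * (X 0 * X 1) + C c5 * X 1 ^ 2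
        = C a0 + C a1 * M + C a2 * L + C a3 * M ^ 2 + C a4 * (M * L) + C a5 * L ^ 2) ∧
      ∀ A B P R : MvPolynomial (Fin 2) ℂ, P = C u' * A + C v' * B → R = C u * A + C v * B →
        C c3 * A ^ 2 + C c4 * (A * B) + C c5 * B ^ 2
          = C a3 * P ^ 2 + C a4 * (P * R) + C a5 * R ^ 2 := by
  -- x = v M - v' L + v' w,  y = -u M + u' L - u' w
  have hd : (C u' * C v - C v' * C u : MvPolynomial (Fin 2) ℂ) = 1 := by
    rw [← C_mul, ← C_mul, ← C_sub, hdet, C_1]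
  refine ⟨c0 + c1 * (v' * w) + c2 * (-u' * w) + c3 * (v' * w) ^ 2 + c4 * (v' * w * (-u' * w))
      + c5 * (-u' * w) ^ 2,
    c1 * v - c2 * u + c3 * (2 * v * (v' * w)) + c4 * (v * (-u' * w) - u * (v' * w))
      + c5 * (2 * u * u' * w),
    -c1 * v' + c2 * u' - c3 * (2 * v' * (v' * w)) + c4 * (v' * u' * w + u' * v' * w)
      - c5 * (2 * u' * u' * w),
    c3 * v ^ 2 - c4 * u * v + c5 * u ^ 2,
    -2 * c3 * v * v' + c4 * (v * u' + u * v') - 2 * c5 * u * u',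
    c3 * v' ^ 2 - c4 * u' * v' + c5 * u' ^ 2, ?_, ?_⟩
  · intro M L hM hL
    have hx : (X 0 : MvPolynomial (Fin 2) ℂ) = C v * M - C v' * L + C v' * C w := by
      rw [hM, hL, linePoly]; linear_combination (-X 0) * hd
    have hy : (X 1 : MvPolynomial (Fin 2) ℂ) = -C u * M + C u' * L - C u' * C w := by
      rw [hM, hL, linePoly]; linear_combination (-X 1) * hd
    rw [hx, hy]
    simp only [map_add, map_sub, map_mul, map_neg, map_pow, map_ofNat]
    ring
  · intro A B P R hP hR
    have hx : A = C v * P - C v' * R := by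
      rw [hP, hR]; linear_combination (-A) * hd
    have hy : B = -C u * P + C u' * R := by
      rw [hP, hR]; linear_combination (-B) * hd
    rw [hx, hy]
    simp only [map_add, map_sub, map_mul, map_neg, map_pow, map_ofNat]
    ring

/-- a non-constant affine polynomial is not a unit -/
lemma aux_nonunit (u v w u' v' : ℂ) (hdet : u' * v - v' * u = 1) (c0 c1 c2 : ℂ)
    (hc : c1 ≠ 0 ∨ c2 ≠ 0)
    (h : IsUnit (C c0 + C c1 * (C u' * X 0 + C v' * X 1) + C c2 * linePoly u v w)) : False := by
  obtain ⟨m, l, hml⟩ : ∃ m l : ℂ, c0 + c1 * m + c2 * l = 0 := by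
    rcases hc with hc | hc
    · exact ⟨-c0 / c1, 0, by field_simp; ring⟩
    · exact ⟨0, -c0 / c2, by field_simp; ring⟩
  have := h.map (MvPolynomial.eval ![v * m - v' * l + v' * w, -u * m + u' * l - u' * w])
  apply this.ne_zero
  simp only [linePoly, map_add, map_mul, eval_C, eval_X, Matrix.cons_val_zero, Matrix.cons_val_one]
  linear_combination hml + (c1 * m + c2 * l - c2 * w) * hdet

lemma aux_field {K : Type*} [Field K] (f3 f2 f1 f0 P R : K) (hR : R ≠ 0)
    (h : f3 * P ^ 3 + f2 * (P ^ 2 * R) + f1 * (P * R ^ 2) + f0 * R ^ 3 = 0) :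
    f3 * (P / R) ^ 3 + f2 * (P / R) ^ 2 + f1 * (P / R) + f0 = 0 := by
  field_simp
  linear_combination h

open Polynomial in
lemma aux_root (P R : ℂ[X]) (hR : R ≠ 0) (f0 f1 f2 f3 : ℂ)
    (hf : ¬ (f0 = 0 ∧ f1 = 0 ∧ f2 = 0 ∧ f3 = 0))
    (h : Polynomial.C f3 * P ^ 3 + Polynomial.C f2 * (P ^ 2 * R) + Polynomial.C f1 * (P * R ^ 2) + Polynomial.C f0 * R ^ 3 = 0) :
    ∃ t : ℂ, P = Polynomial.C t * R ∧ f3 * t ^ 3 + f2 * t ^ 2 + f1 * t + f0 = 0 := by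
  have main : ∃ t : ℂ, P = Polynomial.C t * R := by
    let K := FractionRing ℂ[X]
    let g : ℂ →+* K := (algebraMap ℂ[X] K).comp Polynomial.C
    have hRK : algebraMap ℂ[X] K R ≠ 0 := by
      simpa using hR
    let f : ℂ[X] := Polynomial.C f3 * Polynomial.X ^ 3 + Polynomial.C f2 * Polynomial.X ^ 2
      + Polynomial.C f1 * Polynomial.X + Polynomial.C f0
    have hf0 : f ≠ 0 := by
      intro h0
      apply hf
      have e0 := congrArg (fun r => Polynomial.coeff r 0) h0
      have e1 := congrArg (fun r => Polynomial.coeff r 1) h0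
      have e2 := congrArg (fun r => Polynomial.coeff r 2) h0
      have e3 := congrArg (fun r => Polynomial.coeff r 3) h0
      simp [f, Polynomial.coeff_X, Polynomial.coeff_C, Polynomial.coeff_X_pow] at e0 e1 e2 e3
      exact ⟨e0, e1, e2, e3⟩
    have hroot : (f.map g).IsRoot (algebraMap ℂ[X] K P / algebraMap ℂ[X] K R) := by
      have h2 := congrArg (algebraMap ℂ[X] K) h
      simp only [map_add, map_mul, map_pow, map_zero] at h2
      simp only [f, Polynomial.IsRoot, Polynomial.eval_map, Polynomial.eval₂_add,
        Polynomial.eval₂_mul, Polynomial.eval₂_pow, Polynomial.eval₂_X, Polynomial.eval₂_C, g,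
        RingHom.comp_apply]
      exact aux_field _ _ _ _ _ _ hRK h2
    obtain ⟨t, ht⟩ := (IsAlgClosed.splits f).mem_range_of_isRoot hf0 hroot
    refine ⟨t, ?_⟩
    apply IsFractionRing.injective ℂ[X] K
    rw [eq_div_iff hRK] at ht
    rw [map_mul, ← ht]
    rfl
  obtain ⟨t, rfl⟩ := main
  refine ⟨t, rfl, ?_⟩
  have h' : Polynomial.C (f3 * t ^ 3 + f2 * t ^ 2 + f1 * t + f0) * R ^ 3 = 0 := by
    rw [← h]; simp only [map_add, map_mul, map_pow]; ring
  have h3 := (mul_eq_zero.1 h').resolve_right (pow_ne_zero 3 hR)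
  exact Polynomial.C_eq_zero.1 h3

open Polynomial in
lemma aux_quad_zero (b0 b1 b3 : ℂ)
    (h : Polynomial.C b0 + Polynomial.C b1 * Polynomial.X + Polynomial.C b3 * Polynomial.X ^ 2 = 0) :
    b0 = 0 ∧ b1 = 0 ∧ b3 = 0 := by
  have e0 := congrArg (fun r => Polynomial.coeff r 0) h
  have e1 := congrArg (fun r => Polynomial.coeff r 1) h
  have e2 := congrArg (fun r => Polynomial.coeff r 2) h
  simp [Polynomial.coeff_X, Polynomial.coeff_C, Polynomial.coeff_X_pow] at e0 e1 e2
  exact ⟨e0, e1, e2⟩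

open Polynomial in
lemma aux_core (a0 a1 a2 a3 a4 a5 b0 b1 b2 b3 b4 b5 : ℂ) (P R : ℂ[X])
    (hP : P = Polynomial.C a0 + Polynomial.C a1 * Polynomial.X + Polynomial.C a3 * Polynomial.X ^ 2)
    (hR : R = Polynomial.C b0 + Polynomial.C b1 * Polynomial.X + Polynomial.C b3 * Polynomial.X ^ 2)
    (h1 : (Polynomial.C a2 + Polynomial.C a4 * Polynomial.X) * R ^ 2
      + (Polynomial.C a1 + 2 * Polynomial.C a3 * Polynomial.X - Polynomial.C b2
        - Polynomial.C b4 * Polynomial.X) * (P * R)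
      - (Polynomial.C b1 + 2 * Polynomial.C b3 * Polynomial.X) * P ^ 2 = 0)
    (h2 : R * (Polynomial.C a3 * P ^ 2 + Polynomial.C a4 * (P * R) + Polynomial.C a5 * R ^ 2)
      - P * (Polynomial.C b3 * P ^ 2 + Polynomial.C b4 * (P * R) + Polynomial.C b5 * R ^ 2) = 0) :
    (b0 = 0 ∧ b1 = 0 ∧ b3 = 0) ∨
    (∃ t, a0 = t * b0 ∧ a1 = t * b1 ∧ a2 = t * b2 ∧ a3 = t * b3 ∧ a4 = t * b4 ∧ a5 = t * b5) ∨
    (a3 = 0 ∧ a4 = 0 ∧ a5 = 0 ∧ b3 = 0 ∧ b4 = 0 ∧ b5 = 0) ∨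
    (∃ c k d0 d1 d2 g0 g1 e0 e1 : ℂ, c ≠ 0 ∧ (d1 ≠ 0 ∨ d2 ≠ 0) ∧ k = 0 ∧
      ∀ M L : MvPolynomial (Fin 2) ℂ,
        MvPolynomial.C c * (MvPolynomial.C a0 + MvPolynomial.C a1 * M + MvPolynomial.C a2 * L
          + MvPolynomial.C a3 * M ^ 2 + MvPolynomial.C a4 * (M * L) + MvPolynomial.C a5 * L ^ 2)
          = (MvPolynomial.C d0 + MvPolynomial.C d1 * M + MvPolynomial.C d2 * L) *
            (MvPolynomial.C g0 + MvPolynomial.C g1 * M) ∧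
        MvPolynomial.C c * (MvPolynomial.C b0 + MvPolynomial.C b1 * M + MvPolynomial.C b2 * L
          + MvPolynomial.C b3 * M ^ 2 + MvPolynomial.C b4 * (M * L) + MvPolynomial.C b5 * L ^ 2)
          = (MvPolynomial.C d0 + MvPolynomial.C d1 * M + MvPolynomial.C d2 * L) *
            (MvPolynomial.C e0 + MvPolynomial.C e1 * L)) := by
  by_cases hR0 : R = 0
  · left
    exact aux_quad_zero _ _ _ (hR ▸ hR0)
  right
  by_cases hF : a5 = 0 ∧ a4 - b5 = 0 ∧ a3 - b4 = 0 ∧ -b3 = 0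
  · right
    obtain ⟨rfl, h45, h34, h3⟩ := hF
    obtain rfl : b3 = 0 := by simpa using h3
    obtain rfl : a4 = b5 := sub_eq_zero.1 h45
    obtain rfl : a3 = b4 := sub_eq_zero.1 h34
    have ev : ∀ x : ℂ, (a2 + a4 * x) * (b0 + b1 * x) ^ 2
        + (a1 + a3 * x - b2) * ((a0 + a1 * x + a3 * x ^ 2) * (b0 + b1 * x))
        - b1 * (a0 + a1 * x + a3 * x ^ 2) ^ 2 = 0 := by
      intro x
      have := congrArg (Polynomial.eval x) h1
      rw [hP, hR] at this
      simp at this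
      linear_combination this
    by_cases hb1 : b1 = 0
    · subst hb1
      have hb0 : b0 ≠ 0 := by
        rintro rfl
        apply hR0; rw [hR]; simp
      have ev2 : ∀ x : ℂ, (a2 + a4 * x) * b0
        + (a1 + a3 * x - b2) * (a0 + a1 * x + a3 * x ^ 2) = 0 := by
        intro x
        apply mul_left_cancel₀ hb0
        linear_combination ev x
      have ha3 : a3 = 0 := by
        have : a3 ^ 2 = 0 := by
          linear_combination (ev2 2 - 3 * ev2 1 + 3 * ev2 0 - ev2 (-1)) / 6
        simpa using this
      subst ha3
      have r0 : a2 * b0 + (a1 - b2) * a0 = 0 := by linear_combination ev2 0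
      have r1 : a4 * b0 + (a1 - b2) * a1 = 0 := by linear_combination ev2 1 - ev2 0
      by_cases ha4 : a4 = 0
      · left; simp [ha4]
      right
      refine ⟨b0, 0, b0, 0, -(a1 - b2), a0, a1, b0, a1, hb0, Or.inr ?_, rfl, ?_⟩
      · intro h0
        have h0' : a4 * b0 = 0 := by linear_combination r1 + a1 * h0
        simp [ha4, hb0] at h0'
      · intro M L
        have s0 := congrArg (MvPolynomial.C (σ := Fin 2)) r0
        have s1 := congrArg (MvPolynomial.C (σ := Fin 2)) r1
        simp only [map_add, map_mul, map_sub, map_zero] at s0 s1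
        simp only [map_sub, map_zero, map_neg]
        constructor
        · linear_combination L * s0 + M * L * s1
        · linear_combination L ^ 2 * s1
    · right
      obtain ⟨r, rfl⟩ : ∃ r, b0 = - (b1 * r) := ⟨-b0 / b1, by field_simp⟩
      have hroot : a0 + a1 * r + a3 * r ^ 2 = 0 := by
        have h0 : b1 * (a0 + a1 * r + a3 * r ^ 2) ^ 2 = 0 := by
          linear_combination -ev r
        simpa [hb1] using h0
      obtain rfl : a0 = -(a1 * r + a3 * r ^ 2) := by linear_combination hroot
      have hpoly : (Polynomial.C a2 + Polynomial.C a4 * Polynomial.X) * Polynomial.C b1 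
        - (Polynomial.C a3 * Polynomial.X + Polynomial.C (a1 + a3 * r)) * Polynomial.C (b2 + a3 * r) = 0 := by
        have : (R * (Polynomial.X - Polynomial.C r)) ≠ 0 :=
          mul_ne_zero hR0 (Polynomial.X_sub_C_ne_zero r)
        apply mul_left_cancel₀ this
        rw [mul_zero]
        rw [← h1, hP, hR]
        simp only [map_add, map_mul, map_neg, map_zero, map_pow]
        ring
      have r0 : a2 * b1 = (a1 + a3 * r) * (b2 + a3 * r) := by
        have := congrArg (Polynomial.eval 0) hpoly
        simp at this
        linear_combination this
      have r1 : a4 * b1 = a3 * (b2 + a3 * r) := by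
        have := congrArg (Polynomial.eval 1) hpoly
        simp at this
        linear_combination this - r0
      refine ⟨b1, 0, -(b1 * r), b1, b2 + a3 * r, a1 + a3 * r, a3, b1, a3, hb1, Or.inl hb1, rfl, ?_⟩
      intro M L
      have s0 := congrArg (MvPolynomial.C (σ := Fin 2)) r0
      have s1 := congrArg (MvPolynomial.C (σ := Fin 2)) r1
      simp only [map_add, map_mul] at s0 s1
      simp only [map_add, map_mul, map_zero, map_neg, map_pow]
      constructor
      · linear_combination L * s0 + M * L * s1
      · linear_combination L ^ 2 * s1
  · left
    obtain ⟨t, ht, hft⟩ := aux_root P R hR0 a5 (a4 - b5) (a3 - b4) (-b3) hF (by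
      simp only [map_sub, map_neg]
      linear_combination h2)
    have hc := aux_quad_zero (a0 - t * b0) (a1 - t * b1) (a3 - t * b3) (by
      rw [hP, hR] at ht
      simp only [map_sub, map_mul]
      linear_combination ht)
    obtain ⟨k0, k1, k3⟩ := hc
    have hpoly : Polynomial.C a2 + Polynomial.C a4 * Polynomial.X - Polynomial.C t * Polynomial.C b2
        - Polynomial.C t * Polynomial.C b4 * Polynomial.X = 0 := by
      apply mul_left_cancel₀ (pow_ne_zero 2 hR0)
      rw [mul_zero, ← h1, ht]
      have k1' := congrArg (Polynomial.C) k1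
      have k3' := congrArg (Polynomial.C) k3
      simp only [map_sub, map_mul, map_zero] at k1' k3'
      linear_combination (-R ^ 2 * Polynomial.C t) * k1' - 2 * R ^ 2 * Polynomial.C t * Polynomial.X * k3'
    have r0 : a2 - t * b2 = 0 := by
      have := congrArg (Polynomial.eval 0) hpoly
      simp at this
      linear_combination this
    have r1 : a4 - t * b4 = 0 := by
      have := congrArg (Polynomial.eval 1) hpoly
      simp at this
      linear_combination this - r0
    refine ⟨t, ?_, ?_, ?_, ?_, ?_, ?_⟩
    · linear_combination k0
    · linear_combination k1
    · linear_combination r0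
    · linear_combination k3
    · linear_combination r1
    · linear_combination hft - t ^ 2 * k3 - t * r1

/-- a quadratic polynomial in the frame `M, L` -/
def quadF (a0 a1 a2 a3 a4 a5 : ℂ) (M L : MvPolynomial (Fin 2) ℂ) : MvPolynomial (Fin 2) ℂ :=
  C a0 + C a1 * M + C a2 * L + C a3 * M ^ 2 + C a4 * (M * L) + C a5 * L ^ 2

lemma quadF_pderiv (i : Fin 2) (a0 a1 a2 a3 a4 a5 : ℂ) (M L : MvPolynomial (Fin 2) ℂ) :
    pderiv i (quadF a0 a1 a2 a3 a4 a5 M L)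
      = (C a1 + 2 * C a3 * M + C a4 * L) * pderiv i M
        + (C a2 + C a4 * M + 2 * C a5 * L) * pderiv i L := by
  simp only [quadF, map_add, Derivation.leibniz, Derivation.leibniz_pow, pderiv_C, smul_eq_mul,
    nsmul_eq_mul]
  push_cast
  ring

lemma aux_E1 {A : Type*} [CommRing A] (u v u' v' : A) (hd : u' * v - v' * u = 1)
    (p q pM pL qM qL : A) {PL PM RM W : A}
    (hPL : PL = u' * pL + v' * qL)
    (hPM : PM - W = (u' * pM + v' * qM) - (u * pL + v * qL))
    (hRM : RM = u * pM + v * qM) :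
    (pM * v' + pL * v) * q ^ 2 + ((pM * u' + pL * u) - (qM * v' + qL * v)) * (p * q)
      - (qM * u' + qL * u) * p ^ 2 =
    PL * (u * p + v * q) ^ 2 + (PM - W) * ((u' * p + v' * q) * (u * p + v * q))
      - RM * (u' * p + v' * q) ^ 2 := by
  rw [hPM, hPL, hRM]
  linear_combination (-((pM * v' + pL * v) * q ^ 2
    + ((pM * u' + pL * u) - (qM * v' + qL * v)) * (p * q)
      - (qM * u' + qL * u) * p ^ 2)) * hd

lemma aux_setup (p q : MvPolynomial (Fin 2) ℝ) (hp : p.totalDegree ≤ 2) (hq : q.totalDegree ≤ 2)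
    (u v w u' v' : ℂ) (hdet : u' * v - v' * u = 1) (M L pc qc P R : MvPolynomial (Fin 2) ℂ)
    (hM : M = C u' * X 0 + C v' * X 1) (hL : L = linePoly u v w)
    (hpc : pc = MvPolynomial.map (algebraMap ℝ ℂ) p) (hqc : qc = MvPolynomial.map (algebraMap ℝ ℂ) q)
    (hP : P = C u' * pc + C v' * qc) (hR : R = C u * pc + C v * qc) :
    ∃ a0 a1 a2 a3 a4 a5 b0 b1 b2 b3 b4 b5 : ℂ,
      P = quadF a0 a1 a2 a3 a4 a5 M L ∧ R = quadF b0 b1 b2 b3 b4 b5 M L ∧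
      MvPolynomial.map (algebraMap ℝ ℂ) (Etilde1 p q) =
        (C a2 + C a4 * M + 2 * C a5 * L) * R ^ 2
        + ((C a1 + 2 * C a3 * M + C a4 * L) - (C b2 + C b4 * M + 2 * C b5 * L)) * (P * R)
        - (C b1 + 2 * C b3 * M + C b4 * L) * P ^ 2 ∧
      MvPolynomial.map (algebraMap ℝ ℂ) (Etilde2 p q) =
        R * (C a3 * P ^ 2 + C a4 * (P * R) + C a5 * R ^ 2)
        - P * (C b3 * P ^ 2 + C b4 * (P * R) + C b5 * R ^ 2) := by
  have hd : (C u' * C v - C v' * C u : MvPolynomial (Fin 2) ℂ) = 1 := by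
    rw [← C_mul, ← C_mul, ← C_sub, hdet, C_1]
  obtain ⟨c0, c1, c2, c3, c4, c5, hpf⟩ := aux_form p hp
  obtain ⟨d0, d1, d2, d3, d4, d5, hqf⟩ := aux_form q hq
  obtain ⟨s0, s1, s2, s3, s4, s5, hs, hs2⟩ := aux_frame u v w u' v' hdet c0 c1 c2 c3 c4 c5
  obtain ⟨t0, t1, t2, t3, t4, t5, ht, ht2⟩ := aux_frame u v w u' v' hdet d0 d1 d2 d3 d4 d5
  have hs := hs M L hM hL
  have ht := ht M L hM hL
  have hs2 := hs2 pc qc P R hP hR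
  have ht2 := ht2 pc qc P R hP hR
  have hpc' : pc = quadF s0 s1 s2 s3 s4 s5 M L := by
    rw [quadF, ← hs, hpc, hpf]
    simp
  have hqc' : qc = quadF t0 t1 t2 t3 t4 t5 M L := by
    rw [quadF, ← ht, hqc, hqf]
    simp
  have hP' : P = quadF (u' * s0 + v' * t0) (u' * s1 + v' * t1) (u' * s2 + v' * t2)
      (u' * s3 + v' * t3) (u' * s4 + v' * t4) (u' * s5 + v' * t5) M L := by
    rw [hP, hpc', hqc']; simp only [quadF, map_add, map_mul]; ring
  have hR' : R = quadF (u * s0 + v * t0) (u * s1 + v * t1) (u * s2 + v * t2)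
      (u * s3 + v * t3) (u * s4 + v * t4) (u * s5 + v * t5) M L := by
    rw [hR, hpc', hqc']; simp only [quadF, map_add, map_mul]; ring
  refine ⟨_, _, _, _, _, _, _, _, _, _, _, _, hP', hR', ?_, ?_⟩
  · have hM0 : pderiv 0 M = C u' := by simp [hM, pderiv_X]
    have hM1 : pderiv 1 M = C v' := by simp [hM, pderiv_X]
    have hL0 : pderiv 0 L = C u := by simp [hL, linePoly, pderiv_X]
    have hL1 : pderiv 1 L = C v := by simp [hL, linePoly, pderiv_X]
    have e : MvPolynomial.map (algebraMap ℝ ℂ) (Etilde1 p q) =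
        pderiv 1 pc * qc ^ 2 + (pderiv 0 pc - pderiv 1 qc) * (pc * qc) - pderiv 0 qc * pc ^ 2 := by
      simp only [Etilde1, map_add, map_sub, map_mul, map_pow, hpc, hqc, pderiv_map]
    have p0 := quadF_pderiv 0 s0 s1 s2 s3 s4 s5 M L
    have p1 := quadF_pderiv 1 s0 s1 s2 s3 s4 s5 M L
    have q0 := quadF_pderiv 0 t0 t1 t2 t3 t4 t5 M L
    have q1 := quadF_pderiv 1 t0 t1 t2 t3 t4 t5 M L
    rw [← hpc'] at p0 p1
    rw [← hqc'] at q0 q1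
    rw [hM0, hL0] at p0 q0
    rw [hM1, hL1] at p1 q1
    rw [e, p0, p1, q0, q1, hP, hR]
    clear hpc' hqc' hP' hR' p0 p1 q0 q1 e hs ht hs2 ht2 hpc hqc
    simp only [map_add, map_mul]
    exact aux_E1 _ _ _ _ hd _ _ _ _ _ _ (by ring) (by ring) (by ring)
  · have e : MvPolynomial.map (algebraMap ℝ ℂ) (Etilde2 p q) =
        qc * (C (c3 : ℂ) * pc ^ 2 + C (c4 : ℂ) * (pc * qc) + C (c5 : ℂ) * qc ^ 2)
        - pc * (C (d3 : ℂ) * pc ^ 2 + C (d4 : ℂ) * (pc * qc) + C (d5 : ℂ) * qc ^ 2) := by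
      have e1 := aux_hom c0 c1 c2 c3 c4 c5
      have e2 := aux_hom d0 d1 d2 d3 d4 d5
      rw [← hpf] at e1
      rw [← hqf] at e2
      rw [Etilde2, e1, e2, hpc, hqc]
      simp [algebraMap_eq]
    rw [e, hs2, ht2]
    simp only [map_add, map_mul]
    generalize hS : C s3 * P ^ 2 + C s4 * (P * R) + C s5 * R ^ 2 = S
    generalize hT : C t3 * P ^ 2 + C t4 * (P * R) + C t5 * R ^ 2 = T
    have g1 : (C u' * C s3 + C v' * C t3) * P ^ 2 + (C u' * C s4 + C v' * C t4) * (P * R)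
      + (C u' * C s5 + C v' * C t5) * R ^ 2 = C u' * S + C v' * T := by rw [← hS, ← hT]; ring
    have g2 : (C u * C s3 + C v * C t3) * P ^ 2 + (C u * C s4 + C v * C t4) * (P * R)
      + (C u * C s5 + C v * C t5) * R ^ 2 = C u * S + C v * T := by rw [← hS, ← hT]; ring
    rw [g1, g2, hP, hR]
    linear_combination (pc * T - qc * S) * hd

/-- A line `ux + vy + w = 0` (with `(u,v) ≠ (0,0)`) is invariant for a quadratic system
`ẋ = p, ẏ = q` with `gcd(p,q) = 1` iff `ux + vy + w` is a common factor of `Ẽ1` and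
`Ẽ2` over `ℂ`. -/
theorem invariant_line_iff_common_factor
    (p q : MvPolynomial (Fin 2) ℝ)
    (hdeg : max p.totalDegree q.totalDegree = 2)
    (hgcd : ∀ d : MvPolynomial (Fin 2) ℝ, d ∣ p → d ∣ q → IsUnit d)
    (u v w : ℂ) (huv : (u, v) ≠ (0, 0)) :
    IsInvLine p q u v w ↔
      (linePoly u v w ∣ MvPolynomial.map (algebraMap ℝ ℂ) (Etilde1 p q) ∧
       linePoly u v w ∣ MvPolynomial.map (algebraMap ℝ ℂ) (Etilde2 p q)) := by
  obtain ⟨u', v', hdet⟩ : ∃ u' v' : ℂ, u' * v - v' * u = 1 := by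
    by_cases hv : v = 0
    · have hu : u ≠ 0 := by
        rintro rfl; exact huv (by rw [hv])
      exact ⟨0, -1 / u, by field_simp; ring⟩
    · exact ⟨1 / v, 0, by field_simp; ring⟩
  have hd : (C u' * C v - C v' * C u : MvPolynomial (Fin 2) ℂ) = 1 := by
    rw [← C_mul, ← C_mul, ← C_sub, hdet, C_1]
  have hp : p.totalDegree ≤ 2 := by omega
  have hq : q.totalDegree ≤ 2 := by omega
  have hnu := aux_nonunit u v w u' v' hdet
  have hcop := aux_coprime p q hgcd
  have hM0 : ∃ M : MvPolynomial (Fin 2) ℂ, M = C u' * X 0 + C v' * X 1 := ⟨_, rfl⟩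
  obtain ⟨M, hM⟩ := hM0
  have hL0 : ∃ L : MvPolynomial (Fin 2) ℂ, L = linePoly u v w := ⟨_, rfl⟩
  obtain ⟨L, hL⟩ := hL0
  have hpc0 : ∃ pc : MvPolynomial (Fin 2) ℂ, pc = MvPolynomial.map (algebraMap ℝ ℂ) p := ⟨_, rfl⟩
  obtain ⟨pc, hpc⟩ := hpc0
  have hqc0 : ∃ qc : MvPolynomial (Fin 2) ℂ, qc = MvPolynomial.map (algebraMap ℝ ℂ) q := ⟨_, rfl⟩
  obtain ⟨qc, hqc⟩ := hqc0
  have hP0 : ∃ P : MvPolynomial (Fin 2) ℂ, P = C u' * pc + C v' * qc := ⟨_, rfl⟩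
  obtain ⟨P, hP⟩ := hP0
  have hR0 : ∃ R : MvPolynomial (Fin 2) ℂ, R = C u * pc + C v * qc := ⟨_, rfl⟩
  obtain ⟨R, hR⟩ := hR0
  obtain ⟨a0, a1, a2, a3, a4, a5, b0, b1, b2, b3, b4, b5, hPf, hRf, hE1, hE2⟩ :=
    aux_setup p q hp hq u v w u' v' hdet M L pc qc P R hM hL hpc hqc hP hR
  have hpc' : pc = C v * P - C v' * R := by
    rw [hP, hR]; linear_combination (-pc) * hd
  have hqc' : qc = -C u * P + C u' * R := by
    rw [hP, hR]; linear_combination (-qc) * hd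
  have hinv : IsInvLine p q u v w ↔ L ∣ R := by
    have d0 : pderiv 0 (linePoly u v w) = C u := by simp [linePoly, pderiv_X]
    have d1 : pderiv 1 (linePoly u v w) = C v := by simp [linePoly, pderiv_X]
    rw [IsInvLine, d0, d1, ← hpc, ← hqc, ← hL, hR, mul_comm pc, mul_comm qc]
    rfl
  let φ : MvPolynomial (Fin 2) ℂ →ₐ[ℂ] Polynomial ℂ := MvPolynomial.aeval
    ![Polynomial.C v * Polynomial.X + Polynomial.C (v' * w),
      -Polynomial.C u * Polynomial.X - Polynomial.C (u' * w)]
  have hφC : ∀ c : ℂ, φ (C c) = Polynomial.C c := fun c => by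
    simp [φ, Polynomial.algebraMap_eq]
  have hdP : (Polynomial.C u' * Polynomial.C v - Polynomial.C v' * Polynomial.C u) = 1 := by
    rw [← Polynomial.C_mul, ← Polynomial.C_mul, ← Polynomial.C_sub, hdet, Polynomial.C_1]
  have hφ0 : φ (X 0) = Polynomial.C v * Polynomial.X + Polynomial.C (v' * w) := by simp [φ]
  have hφ1 : φ (X 1) = -Polynomial.C u * Polynomial.X - Polynomial.C (u' * w) := by simp [φ]
  have hφM : φ M = Polynomial.X := by
    rw [hM, map_add, map_mul, map_mul, hφC, hφC, hφ0, hφ1]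
    simp only [map_mul]
    linear_combination Polynomial.X * hdP
  have hφL : φ L = 0 := by
    rw [hL, linePoly, map_add, map_add, map_mul, map_mul, hφC, hφC, hφC, hφ0, hφ1]
    simp only [map_mul]
    linear_combination (-Polynomial.C w) * hdP
  have hφ2 : φ 2 = 2 := map_ofNat φ 2
  have hφP : φ P = Polynomial.C a0 + Polynomial.C a1 * Polynomial.X
      + Polynomial.C a3 * Polynomial.X ^ 2 := by
    rw [hPf]; simp only [quadF, map_add, map_mul, map_pow, hφC, hφM, hφL]; ring
  have hφR : φ R = Polynomial.C b0 + Polynomial.C b1 * Polynomial.X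
      + Polynomial.C b3 * Polynomial.X ^ 2 := by
    rw [hRf]; simp only [quadF, map_add, map_mul, map_pow, hφC, hφM, hφL]; ring
  have hLR : L ∣ R ↔ (b0 = 0 ∧ b1 = 0 ∧ b3 = 0) := by
    constructor
    · rintro ⟨k, hk⟩
      apply aux_quad_zero
      rw [← hφR, hk, map_mul, hφL, zero_mul]
    · rintro ⟨rfl, rfl, rfl⟩
      refine ⟨C b2 + C b4 * M + C b5 * L, ?_⟩
      rw [hRf, quadF]; simp only [map_zero]; ring
  rw [hinv, ← hL]
  constructor
  · intro h
    obtain ⟨rfl, rfl, rfl⟩ := hLR.1 h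
    rw [hE1, hE2]
    obtain ⟨k, hk⟩ := h
    constructor
    · refine ⟨(C a2 + C a4 * M + 2 * C a5 * L) * (k * R)
        + ((C a1 + 2 * C a3 * M + C a4 * L) - (C b2 + C b4 * M + 2 * C b5 * L)) * (P * k)
        - C b4 * P ^ 2, ?_⟩
      rw [hk]; simp only [map_zero]; ring
    · refine ⟨k * (C a3 * P ^ 2 + C a4 * (P * R) + C a5 * R ^ 2)
        - P * (C b4 * (P * k) + C b5 * (k * R)), ?_⟩
      rw [hk]; simp only [map_zero]; ring
  · rintro ⟨⟨k1, h1⟩, ⟨k2, h2⟩⟩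
    rw [hLR]
    rw [hE1] at h1
    rw [hE2] at h2
    have g1 := congrArg φ h1
    have g2 := congrArg φ h2
    simp only [map_add, map_mul, map_sub, map_pow, hφC, hφM, hφL, hφ2, mul_zero, zero_mul,
      add_zero] at g1 g2
    rcases aux_core a0 a1 a2 a3 a4 a5 b0 b1 b2 b3 b4 b5 (φ P) (φ R) hφP hφR
      (by linear_combination g1) (by linear_combination g2) with
      h | ⟨t, rfl, rfl, rfl, rfl, rfl, rfl⟩ | ⟨rfl, rfl, rfl, rfl, rfl, rfl⟩ |
        ⟨c, k, d0, d1, d2, e0, e1, f0, f1, hc, hdd, -, hfac⟩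
    · exact h
    · exfalso
      have hPR : P = C t * R := by
        rw [hPf, hRf]; simp only [quadF, map_mul]; ring
      have hup : pc = R * C (v * t - v') := by
        rw [hpc', hPR]; simp only [map_sub, map_mul]; ring
      have huq : qc = R * C (-u * t + u') := by
        rw [hqc', hPR]; simp only [map_add, map_mul, map_neg]; ring
      have hU := hcop R (hpc ▸ ⟨_, hup⟩) (hqc ▸ ⟨_, huq⟩)
      obtain ⟨r, -, hr⟩ := MvPolynomial.isUnit_iff_eq_C_of_isReduced.1 hU
      have tp : p.totalDegree = 0 := by
        rw [← aux_tdeg p, ← hpc, hup, hr, ← C_mul,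
          totalDegree_C]
      have tq : q.totalDegree = 0 := by
        rw [← aux_tdeg q, ← hqc, huq, hr, ← C_mul,
          totalDegree_C]
      rw [tp, tq] at hdeg
      simp at hdeg
    · exfalso
      have key : ∀ A B D : ℂ, (C A + C B * X 0 + C D * X 1 : MvPolynomial (Fin 2) ℂ).totalDegree ≤ 1 := by
        intro A B D
        refine (totalDegree_add _ _).trans (max_le ((totalDegree_add _ _).trans (max_le ?_ ?_)) ?_)
        · simp
        · exact (totalDegree_mul _ _).trans (by simp)
        · exact (totalDegree_mul _ _).trans (by simp)
      have key2 : ∀ s t : ℂ, (C s * P + C t * R).totalDegree ≤ 1 := by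
        intro s t
        have e : C s * P + C t * R =
          C (s * a0 + t * b0 + (s * a2 + t * b2) * w)
          + C ((s * a1 + t * b1) * u' + (s * a2 + t * b2) * u) * X 0
          + C ((s * a1 + t * b1) * v' + (s * a2 + t * b2) * v) * X 1 := by
          rw [hPf, hRf, hM, hL]
          simp only [quadF, linePoly, map_add, map_mul, map_zero]
          ring
        rw [e]; exact key _ _ _
      have tp : p.totalDegree ≤ 1 := by
        rw [← aux_tdeg p, ← hpc, hpc']
        have := key2 v (-v')
        rwa [map_neg, neg_mul, ← sub_eq_add_neg] at this
      have tq : q.totalDegree ≤ 1 := by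
        rw [← aux_tdeg q, ← hqc, hqc']
        have := key2 (-u) u'
        rwa [map_neg] at this
      omega
    · exfalso
      obtain ⟨hf1, hf2⟩ := hfac M L
      have hc' : (C c⁻¹ * C c : MvPolynomial (Fin 2) ℂ) = 1 := by
        rw [← C_mul, inv_mul_cancel₀ hc, C_1]
      have hP2 : C c * P = (C d0 + C d1 * M + C d2 * L) * (C e0 + C e1 * M) := by rw [hPf]; exact hf1
      have hR2 : C c * R = (C d0 + C d1 * M + C d2 * L) * (C f0 + C f1 * L) := by rw [hRf]; exact hf2
      apply hnu d0 d1 d2 hdd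
      rw [← hM, ← hL]
      have hDP : C d0 + C d1 * M + C d2 * L ∣ P :=
        ⟨C c⁻¹ * (C e0 + C e1 * M), by linear_combination (C c⁻¹) * hP2 - P * hc'⟩
      have hDR : C d0 + C d1 * M + C d2 * L ∣ R :=
        ⟨C c⁻¹ * (C f0 + C f1 * L), by linear_combination (C c⁻¹) * hR2 - R * hc'⟩
      apply hcop
      · rw [← hpc, hpc']
        exact dvd_sub (hDP.mul_left _) (hDR.mul_left _)
      · rw [← hqc, hqc']
        exact dvd_add (hDP.mul_left _) (hDR.mul_left _)
end
end

section
/- The polynomial B3 is invariant under translations of a quadratic differential system: for every (x₀,y₀) ∈ ℝ², if p̃(x,y) = p(x+x₀, y+y₀) and q̃(x,y) = q(x+x₀, y+y₀), then B3 computed from the system (p̃, q̃) is equal, as a polynomial in (x,y), to B3 computed from the system (p, q). -/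
open MvPolynomial

noncomputable section

/-- The monomial exponent `x^i·y^j`. -/
def mono (i j : ℕ) : Fin 2 →₀ ℕ :=
  Finsupp.single (0 : Fin 2) i + Finsupp.single (1 : Fin 2) j

/-- `C2(x,y) = y·p₂(x,y) − x·q₂(x,y)` where `p₂, q₂` are the quadratic homogeneous
parts of `p, q`. -/
def C2of (p q : MvPolynomial (Fin 2) ℝ) : MvPolynomial (Fin 2) ℝ :=
  X 1 * MvPolynomial.homogeneousComponent 2 p
    - X 0 * MvPolynomial.homogeneousComponent 2 q

/-- `D(x,y) = 4·det(c_ij)` where `x·Q(X,Y,Z) − y·P(X,Y,Z)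
  = c11·X² + 2c12·XY + c22·Y² + 2c13·XZ + 2c23·YZ + c33·Z²`,
`P, Q` being the degree-2 homogenizations of `p, q`.  (Writing
`p = a00 + a10·x + a01·y + a20·x² + 2a11·xy + a02·y²` and similarly `q` with `b`'s,
`c11 = b20·x − a20·y`, `c12 = b11·x − a11·y`, `c22 = b02·x − a02·y`,
`c13 = (b10·x − a10·y)/2`, `c23 = (b01·x − a01·y)/2`, `c33 = b00·x − a00·y`.) -/
def Dof (p q : MvPolynomial (Fin 2) ℝ) : MvPolynomial (Fin 2) ℝ :=
  let c11 : MvPolynomial (Fin 2) ℝ :=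
    C (MvPolynomial.coeff (mono 2 0) q) * X 0 - C (MvPolynomial.coeff (mono 2 0) p) * X 1
  let c12 : MvPolynomial (Fin 2) ℝ :=
    C (MvPolynomial.coeff (mono 1 1) q / 2) * X 0
      - C (MvPolynomial.coeff (mono 1 1) p / 2) * X 1
  let c22 : MvPolynomial (Fin 2) ℝ :=
    C (MvPolynomial.coeff (mono 0 2) q) * X 0 - C (MvPolynomial.coeff (mono 0 2) p) * X 1
  let c13 : MvPolynomial (Fin 2) ℝ :=
    C (MvPolynomial.coeff (mono 1 0) q / 2) * X 0
      - C (MvPolynomial.coeff (mono 1 0) p / 2) * X 1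
  let c23 : MvPolynomial (Fin 2) ℝ :=
    C (MvPolynomial.coeff (mono 0 1) q / 2) * X 0
      - C (MvPolynomial.coeff (mono 0 1) p / 2) * X 1
  let c33 : MvPolynomial (Fin 2) ℝ :=
    C (MvPolynomial.coeff (mono 0 0) q) * X 0 - C (MvPolynomial.coeff (mono 0 0) p) * X 1
  4 * Matrix.det !![c11, c12, c13; c12, c22, c23; c13, c23, c33]

/-- `B3 = (C2, D)^(1)`, the Jacobian of `C2` and `D`. -/
def B3of (p q : MvPolynomial (Fin 2) ℝ) : MvPolynomial (Fin 2) ℝ :=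
  pderiv 0 (C2of p q) * pderiv 1 (Dof p q) - pderiv 1 (C2of p q) * pderiv 0 (Dof p q)

/-- The translate of a polynomial: `f(x + x₀, y + y₀)`. -/
def translatePoly (x₀ y₀ : ℝ) (f : MvPolynomial (Fin 2) ℝ) : MvPolynomial (Fin 2) ℝ :=
  MvPolynomial.aeval ![X 0 + C x₀, X 1 + C y₀] f

lemma mono_inj (i j k l : ℕ) : mono i j = mono k l ↔ i = k ∧ j = l := by
  constructor
  · intro h
    have h0 := DFunLike.congr_fun h 0
    have h1 := DFunLike.congr_fun h 1
    simp [mono] at h0 h1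
    exact ⟨h0, h1⟩
  · rintro ⟨rfl, rfl⟩; rfl

lemma eq_mono (m : Fin 2 →₀ ℕ) : m = mono (m 0) (m 1) := by
  ext i
  fin_cases i <;> simp [mono]

lemma mono_degree (i j : ℕ) : (mono i j).degree = i + j := by
  simp [mono]

def quadP (a b c d e f : ℝ) : MvPolynomial (Fin 2) ℝ :=
  monomial (mono 0 0) a + monomial (mono 1 0) b + monomial (mono 0 1) c
  + monomial (mono 2 0) d + monomial (mono 1 1) e + monomial (mono 0 2) f

lemma quadP_eq (a b c d e f : ℝ) : quadP a b c d e f =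
    C a + C b * X 0 + C c * X 1 + C d * X 0 ^ 2 + C e * X 0 * X 1 + C f * X 1 ^ 2 := by
  have key : ∀ i j (r : ℝ), monomial (mono i j) r = C r * X 0 ^ i * X 1 ^ j := by
    intro i j r
    rw [mono, X_pow_eq_monomial, X_pow_eq_monomial, C_mul_monomial, monomial_mul]
    simp
  simp only [quadP, key]
  ring

lemma eq_quadP (p : MvPolynomial (Fin 2) ℝ) (hp : p.totalDegree ≤ 2) :
    ∃ a b c d e f, p = quadP a b c d e f := by
  refine ⟨coeff (mono 0 0) p, coeff (mono 1 0) p, coeff (mono 0 1) p, coeff (mono 2 0) p,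
    coeff (mono 1 1) p, coeff (mono 0 2) p, ?_⟩
  ext m
  rw [eq_mono m]
  generalize m 0 = i
  generalize m 1 = j
  simp only [quadP, coeff_add, coeff_monomial, mono_inj]
  by_cases h : i + j ≤ 2
  · have hi : i ≤ 2 := by omega
    have hj : j ≤ 2 := by omega
    interval_cases i <;> interval_cases j <;> first | omega | simp
  · have h0 : coeff (mono i j) p = 0 := by
      apply coeff_eq_zero_of_totalDegree_lt
      have := mono_degree i j
      rw [Finsupp.degree_apply] at this
      rw [this]
      omega
    rw [h0]
    repeat rw [if_neg (by omega)]
    simp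

lemma hc_quadP (a b c d e f : ℝ) : homogeneousComponent 2 (quadP a b c d e f) =
    C d * X 0 ^ 2 + C e * X 0 * X 1 + C f * X 1 ^ 2 := by
  have h : homogeneousComponent 2 (quadP a b c d e f) = quadP 0 0 0 d e f := by
    ext m
    rw [eq_mono m]
    generalize m 0 = i
    generalize m 1 = j
    rw [coeff_homogeneousComponent, mono_degree]
    simp only [quadP, coeff_add, coeff_monomial, mono_inj]
    split_ifs <;> first | omega | simp
  rw [h, quadP_eq]
  simp

lemma translate_quadP (x y a b c d e f : ℝ) : translatePoly x y (quadP a b c d e f) =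
    quadP (a + b * x + c * y + d * x ^ 2 + e * x * y + f * y ^ 2)
      (b + 2 * d * x + e * y) (c + e * x + 2 * f * y) d e f := by
  rw [quadP_eq, quadP_eq, translatePoly]
  have h2 : (C 2 : MvPolynomial (Fin 2) ℝ) = 2 := map_ofNat C 2
  simp [algebraMap_eq, h2]
  ring

lemma Dof_quadP (a b c d e f a' b' c' d' e' f' : ℝ) :
    Dof (quadP a b c d e f) (quadP a' b' c' d' e' f') =
    4 * (C d' * X 0 - C d * X 1) * (C f' * X 0 - C f * X 1) * (C a' * X 0 - C a * X 1)
    + (C e' * X 0 - C e * X 1) * (C b' * X 0 - C b * X 1) * (C c' * X 0 - C c * X 1)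
    - (C d' * X 0 - C d * X 1) * (C c' * X 0 - C c * X 1) ^ 2
    - (C f' * X 0 - C f * X 1) * (C b' * X 0 - C b * X 1) ^ 2
    - (C a' * X 0 - C a * X 1) * (C e' * X 0 - C e * X 1) ^ 2 := by
  have half : ∀ r : ℝ, (C r : MvPolynomial (Fin 2) ℝ) = 2 * C (r / 2) := by
    intro r
    rw [← map_ofNat C 2, ← C_mul]
    congr 1
    ring
  simp only [Dof, Matrix.det_fin_three, quadP, coeff_add, coeff_monomial, mono_inj]
  simp
  rw [half b, half b', half c, half c', half e, half e']
  ring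

/-- The polynomial `B3` is invariant under translations of a quadratic differential
system. -/
theorem B3_translation_invariant
    (p q : MvPolynomial (Fin 2) ℝ)
    (hdeg : max p.totalDegree q.totalDegree = 2)
    (x₀ y₀ : ℝ) :
    B3of (translatePoly x₀ y₀ p) (translatePoly x₀ y₀ q) = B3of p q := by
  obtain ⟨a, b, c, d, e, f, rfl⟩ := eq_quadP p (by omega)
  obtain ⟨a', b', c', d', e', f', rfl⟩ := eq_quadP q (by omega)
  have h2 : (C 2 : MvPolynomial (Fin 2) ℝ) = 2 := map_ofNat C 2
  rw [translate_quadP, translate_quadP]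
  have hC : ∀ a b c a' b' c' u v w u' v' w' : ℝ,
      C2of (quadP a b c d e f) (quadP a' b' c' d' e' f') =
      C2of (quadP u v w d e f) (quadP u' v' w' d' e' f') := by
    intros
    simp only [C2of, hc_quadP]
  unfold B3of
  rw [hC _ _ _ _ _ _ a b c a' b' c']
  have hD : Dof (quadP (a + b * x₀ + c * y₀ + d * x₀ ^ 2 + e * x₀ * y₀ + f * y₀ ^ 2)
      (b + 2 * d * x₀ + e * y₀) (c + e * x₀ + 2 * f * y₀) d e f)
      (quadP (a' + b' * x₀ + c' * y₀ + d' * x₀ ^ 2 + e' * x₀ * y₀ + f' * y₀ ^ 2)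
      (b' + 2 * d' * x₀ + e' * y₀) (c' + e' * x₀ + 2 * f' * y₀) d' e' f') =
      Dof (quadP a b c d e f) (quadP a' b' c' d' e' f') := by
    rw [Dof_quadP, Dof_quadP]
    simp only [C_add, C_mul, C_pow, h2]
    ring
  rw [hD]
end
end

section
/- For all g, h ∈ ℝ, consider the quadratic system ẋ = gx² + (h+1)xy, ẏ = h[g² + (h+1)²] + (g² + 1 − h²)x + 2ghy − x² + gxy + hy². Then the line x = 0 is an invariant line, and the conic F(x,y) = (x − h − 1)² + (y + g)² is an invariant algebraic curve (there exists k ∈ ℝ[x,y] with p·∂F/∂x + q·∂F/∂y = F·k); equivalently, the two complex conjugate lines (x − h − 1) + i(y + g) = 0 and (x − h − 1) − i(y + g) = 0 are invariant lines. -/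
open MvPolynomial

noncomputable section

/-- The system `ẋ = gx² + (h+1)xy,
`ẏ = h[g²+(h+1)²] + (g²+1−h²)x + 2ghy − x² + gxy + hy²`. -/
def p14 (g h : ℝ) : MvPolynomial (Fin 2) ℝ :=
  C g * X 0 ^ 2 + C (h + 1) * (X 0 * X 1)

def q14 (g h : ℝ) : MvPolynomial (Fin 2) ℝ :=
  C (h * (g ^ 2 + (h + 1) ^ 2)) + C (g ^ 2 + 1 - h ^ 2) * X 0 + C (2 * g * h) * X 1
    - X 0 ^ 2 + C g * (X 0 * X 1) + C h * X 1 ^ 2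

/-- For all `g, h ∈ ℝ`, the system `(p14, q14)` has `x = 0` as an invariant line, the
conic `F = (x−h−1)² + (y+g)²` as an invariant algebraic curve, and equivalently the
two complex conjugate lines `(x−h−1) ± i(y+g) = 0` as invariant lines. -/
theorem config_IV2_invariant_line_and_conic (g h : ℝ) :
    IsInvLine (p14 g h) (q14 g h) 1 0 0 ∧
    (∃ k : MvPolynomial (Fin 2) ℝ,
      p14 g h * pderiv 0 ((X 0 - C (h + 1)) ^ 2 + (X 1 + C g) ^ 2) +
        q14 g h * pderiv 1 ((X 0 - C (h + 1)) ^ 2 + (X 1 + C g) ^ 2) =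
        ((X 0 - C (h + 1)) ^ 2 + (X 1 + C g) ^ 2) * k) ∧
    IsInvLine (p14 g h) (q14 g h) 1 Complex.I (-(h + 1 : ℂ) + Complex.I * (g : ℂ)) ∧
    IsInvLine (p14 g h) (q14 g h) 1 (-Complex.I) (-(h + 1 : ℂ) - Complex.I * (g : ℂ)) := by
  have hI : (C Complex.I : MvPolynomial (Fin 2) ℂ) ^ 2 = -1 := by
    rw [← C_pow, Complex.I_sq]; simp
  refine ⟨⟨C (g : ℂ) * X 0 + C (h + 1 : ℂ) * X 1, ?_⟩,
    ⟨2 * C g * X 0 + 2 * C h * X 1 + 2 * C g * C h, ?_⟩,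
    ⟨(C (g : ℂ) - C Complex.I) * X 0 + C (h : ℂ) * X 1
      + C (h : ℂ) * (C (g : ℂ) - C Complex.I * (C (h : ℂ) + 1)), ?_⟩,
    ⟨(C (g : ℂ) + C Complex.I) * X 0 + C (h : ℂ) * X 1
      + C (h : ℂ) * (C (g : ℂ) + C Complex.I * (C (h : ℂ) + 1)), ?_⟩⟩
  · simp [p14, q14, linePoly, pderiv_X]
    ring
  · have h2 : (C (2:ℝ) : MvPolynomial (Fin 2) ℝ) = 2 := rfl
    simp [p14, q14, pderiv_X, h2]
    ring
  · have h2 : (C (2:ℂ) : MvPolynomial (Fin 2) ℂ) = 2 := rfl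
    simp [p14, q14, linePoly, pderiv_X, h2]
    grind
  · have h2 : (C (2:ℂ) : MvPolynomial (Fin 2) ℂ) = 2 := rfl
    simp [p14, q14, linePoly, pderiv_X, h2]
    grind
end
end

section
/- For every c ∈ ℝ, the invariant affine lines over ℂ of the quadratic system ẋ = 2cx + 2y, ẏ = c² + 1 − x² − y² are exactly the two complex conjugate lines (x − 1) + i(y + c) = 0 and (x − 1) − i(y + c) = 0: both of these lines are invariant, and every invariant affine line ux + vy + w = 0 of the system has (u,v,w) proportional over ℂ to the coefficient triple of one of these two lines. In particular the system has no real invariant affine line. -/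
open MvPolynomial

noncomputable section

/-- The system `ẋ = 2cx + 2y, ẏ = c² + 1 − x² − y²`. -/
def p15 (c : ℝ) : MvPolynomial (Fin 2) ℝ := C (2 * c) * X 0 + C 2 * X 1

def q15 (c : ℝ) : MvPolynomial (Fin 2) ℝ := C (c ^ 2 + 1) - X 0 ^ 2 - X 1 ^ 2

theorem inv_eval_s15 (c : ℝ) (u v w : ℂ) (h : IsInvLine (p15 c) (q15 c) u v w) (x y : ℂ)
    (hxy : u * x + v * y + w = 0) :
    (2 * c * x + 2 * y) * u + (c ^ 2 + 1 - x ^ 2 - y ^ 2) * v = 0 := by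
  obtain ⟨k, hk⟩ := h
  have := congrArg (MvPolynomial.eval ![x, y]) hk
  simpa [linePoly, p15, q15, hxy, pderiv_X] using this

theorem inv_class (c : ℝ) (u v w : ℂ) (huv : (u, v) ≠ (0, 0))
    (h : IsInvLine (p15 c) (q15 c) u v w) :
      (∃ t : ℂ, t ≠ 0 ∧ u = t ∧ v = t * Complex.I ∧
          w = t * (-1 + Complex.I * (c : ℂ))) ∨
      (∃ t : ℂ, t ≠ 0 ∧ u = t ∧ v = t * (-Complex.I) ∧
          w = t * (-1 - Complex.I * (c : ℂ))) := by
  have H := inv_eval_s15 c u v w h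
  by_cases hu : u = 0
  · subst hu
    have hv : v ≠ 0 := by
      rintro rfl
      exact huv rfl
    have h0 := H 0 (-w / v) (by field_simp; ring)
    have h1 := H 1 (-w / v) (by field_simp; ring)
    exact absurd (by linear_combination h0 - h1) hv
  · obtain ⟨a, rfl⟩ : ∃ a, v = u * a := ⟨v / u, by field_simp⟩
    obtain ⟨b, rfl⟩ : ∃ b, w = u * b := ⟨w / u, by field_simp⟩
    have G : ∀ s : ℂ, 2 * c * (-(a * s + b)) + 2 * s
        + (c ^ 2 + 1 - (-(a * s + b)) ^ 2 - s ^ 2) * a = 0 := by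
      intro s
      have := H (-(a * s + b)) s (by ring)
      apply mul_left_cancel₀ hu
      linear_combination this
    have g0 := G 0
    have g1 := G 1
    have g2 := G (-1)
    have e2 : a * (a ^ 2 + 1) = 0 := by linear_combination g0 - (g1 + g2) / 2
    have e1 : 1 - c * a - a ^ 2 * b = 0 := by linear_combination (g1 - g2) / 4
    have ha : a ≠ 0 := by
      rintro rfl
      simp at e1
    have e3 : a ^ 2 + 1 = 0 := (mul_eq_zero.mp e2).resolve_left ha
    have hb : b = c * a - 1 := by linear_combination b * e3 + e1
    have e4 : (a - Complex.I) * (a + Complex.I) = 0 := by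
      linear_combination e3 - Complex.I_sq
    rcases mul_eq_zero.mp e4 with h5 | h5
    · left
      have : a = Complex.I := by linear_combination h5
      subst this
      exact ⟨u, hu, rfl, rfl, by rw [hb]; ring⟩
    · right
      have : a = -Complex.I := by linear_combination h5
      subst this
      exact ⟨u, hu, rfl, rfl, by rw [hb]; ring⟩

theorem inv_line (c : ℝ) (j : ℂ) (hj : j ^ 2 = -1) :
    IsInvLine (p15 c) (q15 c) 1 j (-1 + j * (c : ℂ)) := by
  refine ⟨C (-j) * X 0 - X 1 + C (c - j), ?_⟩
  have hJ : (C j : MvPolynomial (Fin 2) ℂ) ^ 2 = -1 := by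
    rw [← C_pow, hj]; simp
  have h2 : (C 2 : MvPolynomial (Fin 2) ℂ) = 2 := rfl
  simp [linePoly, p15, q15, pderiv_X, h2]
  linear_combination (C (c : ℂ) * X 0 + C (c : ℂ) + X 0 * X 1 + X 1 : MvPolynomial (Fin 2) ℂ) * hJ

/-- For every `c ∈ ℝ`, the invariant affine lines of `ẋ = 2cx + 2y,
`ẏ = c² + 1 − x² − y²` are exactly the two complex conjugate lines
`(x−1) + i(y+c) = 0` and `(x−1) − i(y+c) = 0`; in particular the system has no real
invariant affine line. -/
theorem config_IV27_invariant_lines (c : ℝ) :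
    IsInvLine (p15 c) (q15 c) 1 Complex.I (-1 + Complex.I * (c : ℂ)) ∧
    IsInvLine (p15 c) (q15 c) 1 (-Complex.I) (-1 - Complex.I * (c : ℂ)) ∧
    (∀ u v w : ℂ, (u, v) ≠ (0, 0) → IsInvLine (p15 c) (q15 c) u v w →
      (∃ t : ℂ, t ≠ 0 ∧ u = t ∧ v = t * Complex.I ∧
          w = t * (-1 + Complex.I * (c : ℂ))) ∨
      (∃ t : ℂ, t ≠ 0 ∧ u = t ∧ v = t * (-Complex.I) ∧
          w = t * (-1 - Complex.I * (c : ℂ)))) ∧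
    ¬ ∃ u v w : ℝ, ((u : ℂ), (v : ℂ)) ≠ (0, 0) ∧
        IsInvLine (p15 c) (q15 c) (u : ℂ) (v : ℂ) (w : ℂ) := by
  refine ⟨inv_line c _ Complex.I_sq, ?_, inv_class c, ?_⟩
  · have := inv_line c (-Complex.I) (by simp)
    rwa [show -1 + -Complex.I * (c : ℂ) = -1 - Complex.I * (c : ℂ) by ring] at this
  · rintro ⟨u, v, w, huv, h⟩
    rcases inv_class c u v w huv h with ⟨t, ht, h1, h2, -⟩ | ⟨t, ht, h1, h2, -⟩
    · rw [← h1] at h2 ht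
      have := congrArg Complex.im h2
      simp at this
      exact ht (by simp [← this])
    · rw [← h1] at h2 ht
      have := congrArg Complex.im h2
      simp at this
      exact ht (by simp [this])
end
end

section
/- The quadratic system ẋ = 1, ẏ = y − x² has no invariant affine line: there is no polynomial f = ux + vy + w with u,v,w ∈ ℂ, (u,v) ≠ (0,0), and no k ∈ ℂ[x,y] such that ∂f/∂x + (y − x²)·∂f/∂y = f·k. -/
open MvPolynomial

noncomputable section

/-- The quadratic system `ẋ = 1, ẏ = y − x²` has no invariant affine line. -/
theorem config_IV46_no_invariant_affine_line :
    ¬ ∃ u v w : ℂ, (u, v) ≠ (0, 0) ∧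
        IsInvLine (1 : MvPolynomial (Fin 2) ℝ) (X 1 - X 0 ^ 2) u v w := by
  rintro ⟨u, v, w, huv, k, hk⟩
  have key : ∀ x y : ℂ, u * x + v * y + w = 0 → u + (y - x ^ 2) * v = 0 := by
    intro x y h
    have h2 := congrArg (MvPolynomial.eval ![x, y]) hk
    simp [linePoly, pderiv_X, Pi.single_apply] at h2
    rw [h2, h, zero_mul]
  by_cases hv : v = 0
  · subst hv
    have hu : u ≠ 0 := by
      rintro rfl
      exact huv rfl
    have h := key (-w / u) 0 (by field_simp; ring)
    simp at h
    exact hu h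
  · have h3 : ∀ x : ℂ, u - u * x - w - v * x ^ 2 = 0 := by
      intro x
      have h := key x (-(u * x + w) / v) (by field_simp; ring)
      have e : -(u * x + w) / v * v = -(u * x + w) := by field_simp
      linear_combination h - e
    apply hv
    have a := h3 0
    have b := h3 1
    have c := h3 (-1)
    linear_combination a - (b + c) / 2
end
end

section
/- Let g, k, u ∈ ℝ with g(g−1) ≠ 0 and 4gu² + k(g+1)² ≠ 0. Then the invariant affine lines over ℂ of the quadratic system ẋ = k + gx², ẏ = (y + u)(y + (g−1)x − u) are exactly: the line y + u = 0, and the lines x − r = 0 for each r ∈ ℂ with g·r² + k = 0. That is, all these lines are invariant, and every invariant affine line ux' + vy' + w = 0 of the system is proportional over ℂ to one of them. -/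
open MvPolynomial

noncomputable section

/-- The system `ẋ = k + gx², ẏ = (y+u)(y+(g−1)x−u)`. -/
def p17 (g k : ℝ) : MvPolynomial (Fin 2) ℝ := C k + C g * X 0 ^ 2

def q17 (g u : ℝ) : MvPolynomial (Fin 2) ℝ :=
  (X 1 + C u) * (X 1 + C (g - 1) * X 0 - C u)

/-- For `g(g−1) ≠ 0` and `4gu² + k(g+1)² ≠ 0`, the invariant affine lines of the system
`ẋ = k + gx², ẏ = (y+u)(y+(g−1)x−u)` are exactly `y + u = 0` together with the lines
`x − r = 0` for the roots `r` of `g·r² + k = 0`. -/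
theorem invariant_lines_of_S1_4 (g k u : ℝ)
    (hg : g * (g - 1) ≠ 0) (hB : 4 * g * u ^ 2 + k * (g + 1) ^ 2 ≠ 0) :
    IsInvLine (p17 g k) (q17 g u) 0 1 (u : ℂ) ∧
    (∀ r : ℂ, (g : ℂ) * r ^ 2 + (k : ℂ) = 0 →
      IsInvLine (p17 g k) (q17 g u) 1 0 (-r)) ∧
    (∀ u' v' w' : ℂ, (u', v') ≠ (0, 0) → IsInvLine (p17 g k) (q17 g u) u' v' w' →
      (∃ t : ℂ, t ≠ 0 ∧ u' = 0 ∧ v' = t ∧ w' = t * (u : ℂ)) ∨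
      (∃ t r : ℂ, t ≠ 0 ∧ (g : ℂ) * r ^ 2 + (k : ℂ) = 0 ∧
        u' = t ∧ v' = 0 ∧ w' = -(t * r))) := by
  have hg0 : (g : ℂ) ≠ 0 := by
    intro h; apply hg; rw [Complex.ofReal_eq_zero.mp h]; ring
  have hg1 : (g : ℂ) - 1 ≠ 0 := by
    intro h; apply hg
    have : g - 1 = 0 := by exact_mod_cast h
    rw [this]; ring
  have hB' : 4 * (g : ℂ) * u ^ 2 + k * (g + 1) ^ 2 ≠ 0 := by exact_mod_cast hB
  refine ⟨?_, ?_, ?_⟩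
  · refine ⟨X 1 + C ((g : ℂ) - 1) * X 0 - C (u : ℂ), ?_⟩
    simp [p17, q17, linePoly]
  · intro r hr
    refine ⟨C (g : ℂ) * (X 0 + C r), ?_⟩
    have hk : (k : ℂ) = -(g * r ^ 2) := by linear_combination hr
    simp [p17, q17, linePoly, hk]
    ring
  · intro u' v' w' hne ⟨K, hK⟩
    have key : ∀ x y : ℂ, u' * x + v' * y + w' = 0 →
        (k + g * x ^ 2) * u' + (y + u) * (y + (g - 1) * x - u) * v' = 0 := by
      intro x y hxy
      have h := congrArg (MvPolynomial.eval ![x, y]) hK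
      simp [p17, q17, linePoly, pderiv_X] at h
      rw [hxy, zero_mul] at h
      exact h
    by_cases hv : v' = 0
    · right
      subst hv
      have hu : u' ≠ 0 := by
        rintro rfl; exact hne rfl
      have h := key (-w' / u') 0 (by field_simp; ring)
      refine ⟨u', -w' / u', hu, ?_, rfl, rfl, by field_simp⟩
      apply mul_right_cancel₀ hu
      linear_combination h
    · left
      obtain ⟨m, rfl⟩ : ∃ m, u' = -(v' * m) := ⟨-u' / v', by field_simp⟩
      obtain ⟨c, rfl⟩ : ∃ c, w' = -(v' * c) := ⟨-w' / v', by field_simp⟩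
      have key2 : ∀ x : ℂ,
          (m * x + c + u) * (m * x + c + (g - 1) * x - u) - m * (k + g * x ^ 2) = 0 := by
        intro x
        have h := key x (m * x + c) (by ring)
        apply mul_left_cancel₀ hv
        linear_combination h
      have e0 := key2 0
      have e1 := key2 1
      have e2 := key2 (-1)
      have a2 : m * (m - 1) = 0 := by linear_combination (e1 + e2) / 2 - e0
      have a1 : m * (c - u) + (c + u) * (m + g - 1) = 0 := by linear_combination (e1 - e2) / 2
      rcases mul_eq_zero.mp a2 with hm | hm
      · subst hm
        have : c + u = 0 := by
          apply mul_right_cancel₀ hg1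
          linear_combination a1
        refine ⟨v', hv, by ring, rfl, ?_⟩
        linear_combination -v' * this
      · exfalso
        have hm1 : m = 1 := by linear_combination hm
        subst hm1
        apply hB'
        linear_combination (-(g + 1 : ℂ) ^ 2) * e0 + (c * (1 + g) + u * (1 - g)) * a1
end
end

section
/- For all h, f ∈ ℝ with h ≠ 0, the quadratic system ẋ = hxy, ẏ = fy − x² + hy² has x = 0 as an invariant affine line, and this is its unique invariant affine line over ℂ: every invariant line ux + vy + w = 0 of the system has (u,v,w) proportional over ℂ to (1,0,0). -/
open MvPolynomial

noncomputable section

/-- For all `h, f ∈ ℝ` with `h ≠ 0`, the system `ẋ = hxy, ẏ = fy − x² + hy²` has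
`x = 0` as its unique invariant affine line over `ℂ` (up to proportionality). -/
theorem unique_invariant_line_S4_3 (h f : ℝ) (hh : h ≠ 0) :
    IsInvLine (C h * (X 0 * X 1)) (C f * X 1 - X 0 ^ 2 + C h * X 1 ^ 2) 1 0 0 ∧
    (∀ u v w : ℂ, (u, v) ≠ (0, 0) →
      IsInvLine (C h * (X 0 * X 1)) (C f * X 1 - X 0 ^ 2 + C h * X 1 ^ 2) u v w →
      ∃ t : ℂ, t ≠ 0 ∧ u = t ∧ v = 0 ∧ w = 0) := by
  have hc : (h : ℂ) ≠ 0 := by exact_mod_cast hh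
  constructor
  · refine ⟨C (h : ℂ) * X 1, ?_⟩
    simp [linePoly, pderiv_X]
    ring
  · rintro u v w huv ⟨k, hk⟩
    have key : ∀ x y : ℂ, u * x + v * y + w = 0 →
        h * (x * y) * u + (f * y - x ^ 2 + h * y ^ 2) * v = 0 := by
      intro x y hxy
      have := congrArg (eval ![x, y]) hk
      simp [linePoly, pderiv_X, hxy] at this
      exact this
    by_cases hv : v = 0
    · subst hv
      have hu : u ≠ 0 := by
        rintro rfl
        exact huv rfl
      refine ⟨u, hu, rfl, rfl, ?_⟩
      have := key (-w / u) 1 (by field_simp; ring)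
      field_simp at this
      simpa [hc, hu] using this
    · exfalso
      have h0 := key 0 (-(u * 0 + w) / v) (by field_simp; ring)
      have h1 := key 1 (-(u * 1 + w) / v) (by field_simp; ring)
      have h2 := key (-1) (-(u * (-1) + w) / v) (by field_simp; ring)
      apply hv
      field_simp at h0 h1 h2
      have h3 : v ^ 2 = 0 := by linear_combination h0 - (h1 + h2) / 2
      exact pow_eq_zero_iff (two_ne_zero) |>.1 h3
end
end
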